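/- For every positive integer n, the number of representations of n by x1^2 + x2^2 + 2(x3^2+x4^2+x5^2) + 4(x6^2+x7^2+x8^2) equals (8/11)σ_{3;χ8,1}(n) + (2/11)σ_{3;1,χ8}(n/2) + (2/11)a1(n) + (34/11)a2(n) + (92/11)a1(n/2) + (16/11)a2(n/2), with terms of non-integer argument interpreted as 0. -/

import Mathlib

open Complex Real Finset

/-- The Dedekind eta function `η(z) = q^{1/24} ∏ (1 - q^m)`, `q = e^{2πiz}`. -/
noncomputable def dedekindEta (z : ℂ) : ℂ :=
  Complex.exp (Real.pi * Complex.I * z / 12) *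
    ∏' m : ℕ, (1 - Complex.exp (2 * Real.pi * Complex.I * (m + 1) * z))

/-- `repCount a n` is the number of `(x₁,…,x₈) ∈ ℤ⁸` with `∑ aᵢ xᵢ² = n`. -/
noncomputable def repCount (a : Fin 8 → ℕ) (n : ℕ) : ℕ :=
  Nat.card {x : Fin 8 → ℤ // ∑ i, (a i : ℤ) * x i ^ 2 = (n : ℤ)}

/-- `σ_{3;1,χ₈}(n) = ∑_{d ∣ n} χ₈(d) d³`. -/
def sigmaOneChi8 (n : ℕ) : ℤ := ∑ d ∈ n.divisors, ZMod.χ₈ (d : ZMod 8) * (d : ℤ) ^ 3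

/-- `σ_{3;χ₈,1}(n) = ∑_{d ∣ n} χ₈(n/d) d³`. -/
def sigmaChi8One (n : ℕ) : ℤ := ∑ d ∈ n.divisors, ZMod.χ₈ ((n / d : ℕ) : ZMod 8) * (d : ℤ) ^ 3

/-- `f(n/2)` when `2 ∣ n`, and `0` otherwise. -/
def half (f : ℕ → ℤ) (n : ℕ) : ℚ := if 2 ∣ n then (f (n / 2) : ℚ) else 0


/-- Moments of theta series `∑ (n+s)^k exp(t (n+s)^2 + (n+s) u)`. -/
noncomputable def Jth (k : ℕ) (s : ℝ) (t u : ℂ) : ℂ :=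
  ∑' n : ℤ, ((n : ℂ) + s) ^ k * Complex.exp (t * ((n : ℂ) + s) ^ 2 + ((n : ℂ) + s) * u)

lemma summable_exp_neg_abs_int : Summable (fun n : ℤ => Real.exp (-|(n : ℝ)|)) := by
  apply Summable.of_nat_of_neg
  · simpa using Real.summable_exp_neg_nat
  · simpa using Real.summable_exp_neg_nat

/-- The uniform bound for the terms. -/
noncomputable def thBound (k : ℕ) (s r M : ℝ) (n : ℤ) : ℝ :=
  (k.factorial * Real.exp ((M + 2) ^ 2 / (4 * r)) * Real.exp |s|) * Real.exp (-|(n : ℝ)|)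

lemma summable_thBound (k : ℕ) (s r M : ℝ) : Summable (thBound k s r M) :=
  summable_exp_neg_abs_int.mul_left _

lemma norm_term_le (k : ℕ) (s : ℝ) {r M : ℝ} (hr : 0 < r) {t u : ℂ} (ht : t.re ≤ -r)
    (hu : |u.re| ≤ M) (n : ℤ) :
    ‖((n : ℂ) + s) ^ k * Complex.exp (t * ((n : ℂ) + s) ^ 2 + ((n : ℂ) + s) * u)‖
      ≤ thBound k s r M n := by
  have e1 : ((n : ℂ) + s) = (((n : ℝ) + s : ℝ) : ℂ) := by push_cast; rfl
  rw [e1]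
  set y : ℝ := (n : ℝ) + s with hy
  rw [norm_mul, norm_pow, Complex.norm_exp, Complex.norm_real, Real.norm_eq_abs]
  have e2 : (t * (y : ℂ) ^ 2 + (y : ℂ) * u).re = t.re * y ^ 2 + y * u.re := by
    rw [← Complex.ofReal_pow]
    rw [Complex.add_re, Complex.re_mul_ofReal, Complex.re_ofReal_mul]
  rw [e2]
  have h1 : |y| ^ k ≤ k.factorial * Real.exp |y| := by
    have := Real.pow_div_factorial_le_exp |y| (abs_nonneg y) k
    rw [div_le_iff₀ (by positivity)] at this
    linarith
  have h2 : t.re * y ^ 2 + y * u.re ≤ -r * y ^ 2 + M * |y| := by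
    have a1 : t.re * y ^ 2 ≤ -r * y ^ 2 := by gcongr
    have a2 : y * u.re ≤ |y| * |u.re| := by rw [← abs_mul]; exact le_abs_self _
    have a3 : |y| * |u.re| ≤ |y| * M := by gcongr
    linarith
  have h3 : |y| + (-r * y ^ 2 + M * |y|) ≤ (M + 2) ^ 2 / (4 * r) + |s| + -|(n : ℝ)| := by
    have a1 : |(n : ℝ)| ≤ |y| + |s| := by
      have : (n : ℝ) = y - s := by rw [hy]; ring
      rw [this]; exact abs_sub _ _
    have a2 : (M + 2) * |y| - r * y ^ 2 ≤ (M + 2) ^ 2 / (4 * r) := by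
      rw [le_div_iff₀ (by positivity)]
      have : y ^ 2 = |y| ^ 2 := (sq_abs y).symm
      rw [this]
      nlinarith [sq_nonneg (2 * r * |y| - (M + 2))]
    linarith
  calc |y| ^ k * Real.exp (t.re * y ^ 2 + y * u.re)
      ≤ (k.factorial * Real.exp |y|) * Real.exp (-r * y ^ 2 + M * |y|) := by gcongr
    _ = k.factorial * Real.exp (|y| + (-r * y ^ 2 + M * |y|)) := by
        rw [Real.exp_add |y|]; ring
    _ ≤ k.factorial * Real.exp ((M + 2) ^ 2 / (4 * r) + |s| + -|(n : ℝ)|) := by gcongr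
    _ = thBound k s r M n := by
        rw [Real.exp_add, Real.exp_add, thBound]; ring

lemma summable_Jth_norm (k : ℕ) (s : ℝ) {t : ℂ} (ht : t.re < 0) (u : ℂ) :
    Summable fun n : ℤ =>
      ‖((n : ℂ) + s) ^ k * Complex.exp (t * ((n : ℂ) + s) ^ 2 + ((n : ℂ) + s) * u)‖ :=
  Summable.of_nonneg_of_le (fun _ => norm_nonneg _)
    (fun n => norm_term_le k s (r := -t.re) (by linarith) (by linarith) le_rfl n)
    (summable_thBound k s _ _)

lemma summable_Jth (k : ℕ) (s : ℝ) {t : ℂ} (ht : t.re < 0) (u : ℂ) :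
    Summable fun n : ℤ =>
      ((n : ℂ) + s) ^ k * Complex.exp (t * ((n : ℂ) + s) ^ 2 + ((n : ℂ) + s) * u) :=
  (summable_Jth_norm k s ht u).of_norm

lemma Jth_hasDerivAt_u (k : ℕ) (s : ℝ) {t : ℂ} (ht : t.re < 0) (u : ℂ) :
    HasDerivAt (fun u => Jth k s t u) (Jth (k + 1) s t u) u := by
  set U : Set ℂ := {w | |w.re| < |u.re| + 1} with hU
  have hUo : IsOpen U := isOpen_lt (by fun_prop) (by fun_prop)
  have hz : u ∈ U := by simp [hU]
  have hb : ∀ (n : ℤ), ∀ w ∈ U,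
      ‖((n : ℂ) + s) ^ k * Complex.exp (t * ((n : ℂ) + s) ^ 2 + ((n : ℂ) + s) * w)‖
        ≤ thBound k s (-t.re) (|u.re| + 1) n := fun n w hw =>
    norm_term_le k s (r := -t.re) (by linarith) (by linarith) (le_of_lt hw) n
  have hd : ∀ n : ℤ, DifferentiableOn ℂ (fun w : ℂ =>
      ((n : ℂ) + s) ^ k * Complex.exp (t * ((n : ℂ) + s) ^ 2 + ((n : ℂ) + s) * w)) U :=
    fun n => by fun_prop
  have h1 := Complex.hasSum_deriv_of_summable_norm (summable_thBound k s _ _) hd hUo hb hz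
  have h2 := (Complex.differentiableOn_tsum_of_summable_norm (summable_thBound k s _ _) hd hUo
    hb).differentiableAt (hUo.mem_nhds hz)
  have h3 := h2.hasDerivAt
  have h4 : deriv (fun w : ℂ => ∑' n : ℤ, ((n : ℂ) + s) ^ k *
      Complex.exp (t * ((n : ℂ) + s) ^ 2 + ((n : ℂ) + s) * w)) u = Jth (k + 1) s t u := by
    rw [← h1.tsum_eq, Jth]
    refine tsum_congr fun n => ?_
    have : HasDerivAt (fun w : ℂ => ((n : ℂ) + s) ^ k *
        Complex.exp (t * ((n : ℂ) + s) ^ 2 + ((n : ℂ) + s) * w))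
        (((n : ℂ) + s) ^ k * (Complex.exp (t * ((n : ℂ) + s) ^ 2 + ((n : ℂ) + s) * u) *
          (((n : ℂ) + s) * 1))) u :=
      ((((hasDerivAt_id u).const_mul ((n : ℂ) + s)).const_add _).cexp).const_mul _
    rw [this.deriv]; ring
  rw [h4] at h3
  exact h3

lemma Jth_hasDerivAt_t (k : ℕ) (s : ℝ) {t : ℂ} (ht : t.re < 0) (u : ℂ) :
    HasDerivAt (fun t => Jth k s t u) (Jth (k + 2) s t u) t := by
  set U : Set ℂ := {w | w.re < t.re / 2} with hU
  have hUo : IsOpen U := isOpen_lt (by fun_prop) (by fun_prop)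
  have hz : t ∈ U := by change t.re < t.re / 2; linarith
  have hb : ∀ (n : ℤ), ∀ w ∈ U,
      ‖((n : ℂ) + s) ^ k * Complex.exp (w * ((n : ℂ) + s) ^ 2 + ((n : ℂ) + s) * u)‖
        ≤ thBound k s (-(t.re / 2)) (|u.re|) n := fun n w hw =>
    norm_term_le k s (r := -(t.re / 2)) (by linarith) (by
      have : w.re < t.re / 2 := hw
      linarith) le_rfl n
  have hd : ∀ n : ℤ, DifferentiableOn ℂ (fun w : ℂ =>
      ((n : ℂ) + s) ^ k * Complex.exp (w * ((n : ℂ) + s) ^ 2 + ((n : ℂ) + s) * u)) U :=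
    fun n => by fun_prop
  have h1 := Complex.hasSum_deriv_of_summable_norm (summable_thBound k s _ _) hd hUo hb hz
  have h2 := (Complex.differentiableOn_tsum_of_summable_norm (summable_thBound k s _ _) hd hUo
    hb).differentiableAt (hUo.mem_nhds hz)
  have h3 := h2.hasDerivAt
  have h4 : deriv (fun w : ℂ => ∑' n : ℤ, ((n : ℂ) + s) ^ k *
      Complex.exp (w * ((n : ℂ) + s) ^ 2 + ((n : ℂ) + s) * u)) t = Jth (k + 2) s t u := by
    rw [← h1.tsum_eq, Jth]
    refine tsum_congr fun n => ?_
    have : HasDerivAt (fun w : ℂ => ((n : ℂ) + s) ^ k *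
        Complex.exp (w * ((n : ℂ) + s) ^ 2 + ((n : ℂ) + s) * u))
        (((n : ℂ) + s) ^ k * (Complex.exp (t * ((n : ℂ) + s) ^ 2 + ((n : ℂ) + s) * u) *
          (1 * ((n : ℂ) + s) ^ 2))) t :=
      ((((hasDerivAt_id t).mul_const (((n : ℂ) + s) ^ 2)).add_const _).cexp).const_mul _
    rw [this.deriv]; ring
  rw [h4] at h3
  exact h3

/-! ### Symmetries -/

lemma Jth_zero_neg (t u : ℂ) : Jth 0 0 t (-u) = Jth 0 0 t u := by
  unfold Jth
  rw [← (Equiv.neg ℤ).tsum_eq]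
  refine tsum_congr fun n => ?_
  simp

lemma Jth_half_neg (t u : ℂ) : Jth 0 (1 / 2) t (-u) = Jth 0 (1 / 2) t u := by
  unfold Jth
  rw [← ((Equiv.neg ℤ).trans (Equiv.subRight 1)).tsum_eq]
  refine tsum_congr fun n => ?_
  simp only [Equiv.trans_apply, Equiv.neg_apply, Equiv.subRight_apply]
  push_cast
  rw [pow_zero, pow_zero]
  congr 2
  ring

lemma exp_int_two_pi (n : ℤ) (w : ℂ) : Complex.exp (w + n * (2 * π * I)) = Complex.exp w := by
  rw [Complex.exp_add, Complex.exp_int_mul_two_pi_mul_I, mul_one]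

lemma Jth_zero_add_two_pi (k : ℕ) (t u : ℂ) : Jth k 0 t (u + 2 * π * I) = Jth k 0 t u := by
  unfold Jth
  refine tsum_congr fun n => ?_
  congr 1
  rw [← exp_int_two_pi n (t * ((n : ℂ) + (0 : ℝ)) ^ 2 + ((n : ℂ) + (0 : ℝ)) * u)]
  congr 1
  push_cast; ring

lemma Jth_half_add_two_pi (k : ℕ) (t u : ℂ) :
    Jth k (1 / 2) t (u + 2 * π * I) = - Jth k (1 / 2) t u := by
  unfold Jth
  rw [← tsum_neg]
  refine tsum_congr fun n => ?_
  have : Complex.exp (t * ((n : ℂ) + (1 / 2 : ℝ)) ^ 2 + ((n : ℂ) + (1 / 2 : ℝ)) * (u + 2 * π * I))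
      = - Complex.exp (t * ((n : ℂ) + (1 / 2 : ℝ)) ^ 2 + ((n : ℂ) + (1 / 2 : ℝ)) * u) := by
    rw [← exp_int_two_pi n (t * ((n : ℂ) + (1 / 2 : ℝ)) ^ 2 + ((n : ℂ) + (1 / 2 : ℝ)) * u)]
    rw [← mul_neg_one (Complex.exp _), ← Complex.exp_pi_mul_I, ← Complex.exp_add]
    congr 1
    push_cast; ring
  rw [this]; ring

/-- relation of the half shift to the zero shift -/
lemma Jth_half_eq (t u : ℂ) :
    Jth 0 (1 / 2) t u = Complex.exp (t / 4 + u / 2) * Jth 0 0 t (u + t) := by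
  unfold Jth
  rw [← tsum_mul_left]
  refine tsum_congr fun n => ?_
  rw [pow_zero, pow_zero, one_mul, one_mul, ← Complex.exp_add]
  congr 1
  push_cast; ring

lemma Jth_zero_eq (t u : ℂ) :
    Jth 0 0 t u = Complex.exp (t / 4 + u / 2) * Jth 0 (1 / 2) t (u + t) := by
  unfold Jth
  rw [← tsum_mul_left, ← (Equiv.addRight (1 : ℤ)).tsum_eq]
  refine tsum_congr fun n => ?_
  rw [pow_zero, pow_zero, one_mul, one_mul, ← Complex.exp_add]
  congr 1
  simp only [Equiv.coe_addRight]
  push_cast; ring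

/-- shift `t ↦ t + π i` -/
lemma Jth_zero_shift (k : ℕ) (t u : ℂ) : Jth k 0 (t + π * I) u = Jth k 0 t (u + π * I) := by
  unfold Jth
  refine tsum_congr fun n => ?_
  congr 1
  obtain ⟨m, hm⟩ : ∃ m : ℤ, n ^ 2 - n = 2 * m := by
    obtain ⟨m, hm⟩ := Int.even_mul_pred_self n
    exact ⟨m, by nlinarith⟩
  rw [← exp_int_two_pi m (t * ((n : ℂ) + (0 : ℝ)) ^ 2 + ((n : ℂ) + (0 : ℝ)) * (u + π * I))]
  congr 1
  have : (n : ℂ) ^ 2 = n + 2 * m := by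
    have : (((n ^ 2 - n : ℤ)) : ℂ) = ((2 * m : ℤ) : ℂ) := by rw [hm]
    push_cast at this
    linear_combination this
  push_cast
  linear_combination (π * I) * this

lemma Jth_half_shift (k : ℕ) (t u : ℂ) :
    Jth k (1 / 2) (t + π * I) u = Complex.exp (π * I / 4) * Jth k (1 / 2) t u := by
  unfold Jth
  rw [← tsum_mul_left]
  refine tsum_congr fun n => ?_
  rw [mul_left_comm]
  congr 1
  rw [← Complex.exp_add]
  obtain ⟨m, hm⟩ : ∃ m : ℤ, n ^ 2 + n = 2 * m := by
    obtain ⟨m, hm⟩ := Int.even_mul_succ_self n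
    exact ⟨m, by nlinarith⟩
  rw [← exp_int_two_pi m (π * I / 4 + _)]
  congr 1
  have : (n : ℂ) ^ 2 = - n + 2 * m := by
    have : (((n ^ 2 + n : ℤ)) : ℂ) = ((2 * m : ℤ) : ℂ) := by rw [hm]
    push_cast at this
    linear_combination this
  push_cast
  linear_combination (π * I) * this

/-! ### Splitting sums over `ℤ` and `ℤ × ℤ` -/

/-- The rotation of the square lattice. -/
noncomputable def rotEquiv : (ℤ × ℤ) ⊕ (ℤ × ℤ) ≃ ℤ × ℤ :=
  Equiv.ofBijective
    (Sum.elim (fun p => (p.1 + p.2, p.1 - p.2)) (fun p => (p.1 + p.2 + 1, p.1 - p.2))) (by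
    constructor
    · rintro (⟨a, b⟩ | ⟨a, b⟩) (⟨c, d⟩ | ⟨c, d⟩) h <;>
        simp only [Sum.elim_inl, Sum.elim_inr, Prod.mk.injEq] at h
      · have h1 : a = c := by omega
        have h2 : b = d := by omega
        rw [h1, h2]
      · omega
      · omega
      · have h1 : a = c := by omega
        have h2 : b = d := by omega
        rw [h1, h2]
    · rintro ⟨m, n⟩
      rcases Int.even_or_odd' (m + n) with ⟨k, hk | hk⟩
      · exact ⟨Sum.inl (k, m - k), by
          simp only [Sum.elim_inl, Prod.mk.injEq]; constructor <;> omega⟩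
      · exact ⟨Sum.inr (k, m - 1 - k), by
          simp only [Sum.elim_inr, Prod.mk.injEq]; constructor <;> omega⟩)

lemma tsum_rot {f : ℤ × ℤ → ℂ} (hf : Summable f) :
    ∑' p, f p = (∑' p : ℤ × ℤ, f (p.1 + p.2, p.1 - p.2))
      + ∑' p : ℤ × ℤ, f (p.1 + p.2 + 1, p.1 - p.2) := by
  rw [← rotEquiv.tsum_eq]
  have h := (rotEquiv.summable_iff (f := f)).mpr hf
  have h1 : Summable ((f ∘ rotEquiv) ∘ Sum.inl) := h.comp_injective Sum.inl_injective
  have h2 : Summable ((f ∘ rotEquiv) ∘ Sum.inr) := h.comp_injective Sum.inr_injective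
  exact (HasSum.sum h1.hasSum h2.hasSum).tsum_eq

lemma tsum_rot' {f : ℤ × ℤ → ℂ} (hf : Summable f) :
    ∑' p, f p = (∑' p : ℤ × ℤ, f (p.1 + p.2, p.1 - p.2))
      + ∑' p : ℤ × ℤ, f (p.1 + p.2, p.1 - p.2 - 1) := by
  rw [tsum_rot hf]
  congr 1
  rw [← ((Equiv.subRight (1 : ℤ)).prodCongr (Equiv.refl ℤ)).tsum_eq]
  refine tsum_congr fun p => ?_
  simp only [Equiv.prodCongr_apply, Prod.map, Equiv.subRight_apply, Equiv.refl_apply]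
  congr 2 <;> ring

/-- Parity of integers. -/
noncomputable def parityEquiv : ℤ ⊕ ℤ ≃ ℤ :=
  Equiv.ofBijective (Sum.elim (fun n => 2 * n) (fun n => 2 * n + 1)) (by
    constructor
    · rintro (a | a) (b | b) h <;> simp only [Sum.elim_inl, Sum.elim_inr] at h
      · have h1 : a = b := by omega
        rw [h1]
      · omega
      · omega
      · have h1 : a = b := by omega
        rw [h1]
    · intro n
      rcases Int.even_or_odd' n with ⟨k, hk | hk⟩
      · exact ⟨Sum.inl k, hk.symm⟩
      · exact ⟨Sum.inr k, hk.symm⟩)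

lemma tsum_parity {f : ℤ → ℂ} (hf : Summable f) :
    ∑' n, f n = (∑' n : ℤ, f (2 * n)) + ∑' n : ℤ, f (2 * n + 1) := by
  rw [← parityEquiv.tsum_eq]
  have h := (parityEquiv.summable_iff (f := f)).mpr hf
  have h1 : Summable ((f ∘ parityEquiv) ∘ Sum.inl) := h.comp_injective Sum.inl_injective
  have h2 : Summable ((f ∘ parityEquiv) ∘ Sum.inr) := h.comp_injective Sum.inr_injective
  exact (HasSum.sum h1.hasSum h2.hasSum).tsum_eq

/-- Splitting into even and odd indices -/
lemma Jth_split {t : ℂ} (ht : t.re < 0) (u : ℂ) :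
    Jth 0 0 t u = Jth 0 0 (4 * t) (2 * u) + Jth 0 (1 / 2) (4 * t) (2 * u) := by
  have hs := summable_Jth 0 0 ht u
  unfold Jth
  rw [tsum_parity hs]
  congr 1 <;> refine tsum_congr fun n => ?_
  · simp only [pow_zero, one_mul]
    congr 1
    push_cast; ring
  · simp only [pow_zero, one_mul]
    congr 1
    push_cast; ring


lemma Jth_mul_tsum (a b : ℕ) (s s' : ℝ) {t t' : ℂ} (ht : t.re < 0) (ht' : t'.re < 0) (u v : ℂ) :
    HasSum (fun p : ℤ × ℤ =>
      (((p.1 : ℂ) + s) ^ a * Complex.exp (t * ((p.1 : ℂ) + s) ^ 2 + ((p.1 : ℂ) + s) * u)) *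
      (((p.2 : ℂ) + s') ^ b * Complex.exp (t' * ((p.2 : ℂ) + s') ^ 2 + ((p.2 : ℂ) + s') * v)))
      (Jth a s t u * Jth b s' t' v) := by
  have h1 := summable_Jth_norm a s ht u
  have h2 := summable_Jth_norm b s' ht' v
  unfold Jth
  rw [tsum_mul_tsum_of_summable_norm h1 h2]
  exact (summable_mul_of_summable_norm h1 h2).hasSum

/-- Product formula. -/
lemma Jth_mul {t : ℂ} (ht : t.re < 0) (u v : ℂ) :
    Jth 0 0 t u * Jth 0 0 t v = Jth 0 0 (2 * t) (u + v) * Jth 0 0 (2 * t) (u - v)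
      + Jth 0 (1 / 2) (2 * t) (u + v) * Jth 0 (1 / 2) (2 * t) (u - v) := by
  have h := Jth_mul_tsum 0 0 0 0 ht ht u v
  have ht2 : (2 * t).re < 0 := by simp; linarith
  rw [← h.tsum_eq, tsum_rot h.summable, ← (Jth_mul_tsum 0 0 0 0 ht2 ht2 _ _).tsum_eq,
    ← (Jth_mul_tsum 0 0 (1 / 2) (1 / 2) ht2 ht2 _ _).tsum_eq]
  congr 1 <;> refine tsum_congr fun p => ?_
  · simp only [pow_zero, one_mul, ← Complex.exp_add]
    congr 1
    push_cast; ring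
  · simp only [pow_zero, one_mul, ← Complex.exp_add]
    congr 1
    push_cast; ring

/-- The terms of the weighted double series. -/
noncomputable def wTerm (k : ℕ) (t v : ℂ) (p : ℤ × ℤ) : ℂ :=
  ((p.1 : ℂ) - p.2) ^ k * (Complex.exp (t * ((p.1 : ℂ) + (1 / 2 : ℝ)) ^ 2
    + ((p.1 : ℂ) + (1 / 2 : ℝ)) * v) * Complex.exp (t * ((p.2 : ℂ) + (1 / 2 : ℝ)) ^ 2
    + ((p.2 : ℂ) + (1 / 2 : ℝ)) * v))

lemma wTerm_tsum (k : ℕ) {t : ℂ} (ht : t.re < 0) (v : ℂ) (h : Summable (wTerm k t v)) :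
    ∑' p, wTerm k t v p = 2 ^ k * (Jth 0 0 (2 * t) (2 * v) * Jth k (1 / 2) (2 * t) 0
      + Jth 0 (1 / 2) (2 * t) (2 * v) * Jth k 0 (2 * t) 0) := by
  have ht2 : (2 * t).re < 0 := by simp; linarith
  rw [tsum_rot' h, mul_add, ← (Jth_mul_tsum 0 k 0 (1 / 2) ht2 ht2 _ _).tsum_eq,
    ← (Jth_mul_tsum 0 k (1 / 2) 0 ht2 ht2 _ _).tsum_eq, ← tsum_mul_left, ← tsum_mul_left, add_comm]
  congr 1 <;> refine tsum_congr fun p => ?_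
  · simp only [wTerm, pow_zero, one_mul]
    rw [← Complex.exp_add, mul_left_comm (Complex.exp _), ← Complex.exp_add, ← mul_assoc, ← mul_pow]
    congr 2
    · push_cast; ring
    · push_cast; ring
  · simp only [wTerm, pow_zero, one_mul]
    rw [← Complex.exp_add, mul_left_comm (Complex.exp _), ← Complex.exp_add, ← mul_assoc, ← mul_pow]
    congr 2
    · push_cast; ring
    · push_cast; ring

lemma Jhalf_sq {t : ℂ} (ht : t.re < 0) (v : ℂ) :
    Jth 0 (1 / 2) t v ^ 2 = Jth 0 0 (2 * t) (2 * v) * Jth 0 (1 / 2) (2 * t) 0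
      + Jth 0 (1 / 2) (2 * t) (2 * v) * Jth 0 0 (2 * t) 0 := by
  have h : HasSum (wTerm 0 t v) (Jth 0 (1 / 2) t v ^ 2) := by
    rw [sq]
    convert Jth_mul_tsum 0 0 (1 / 2) (1 / 2) ht ht v v using 2 with p
    simp [wTerm]
  rw [← h.tsum_eq, wTerm_tsum 0 ht v h.summable]
  simp

lemma Jhalf_two {t : ℂ} (ht : t.re < 0) (v : ℂ) :
    Jth 2 (1 / 2) t v * Jth 0 (1 / 2) t v - Jth 1 (1 / 2) t v ^ 2
      = 2 * (Jth 0 0 (2 * t) (2 * v) * Jth 2 (1 / 2) (2 * t) 0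
      + Jth 0 (1 / 2) (2 * t) (2 * v) * Jth 2 0 (2 * t) 0) := by
  have h : HasSum (wTerm 2 t v)
      (2 * (Jth 2 (1 / 2) t v * Jth 0 (1 / 2) t v - Jth 1 (1 / 2) t v ^ 2)) := by
    have h20 := Jth_mul_tsum 2 0 (1 / 2) (1 / 2) ht ht v v
    have h02 := Jth_mul_tsum 0 2 (1 / 2) (1 / 2) ht ht v v
    have h11 := Jth_mul_tsum 1 1 (1 / 2) (1 / 2) ht ht v v
    convert (h20.add h02).sub (h11.mul_left 2) using 1
    · rfl
    · funext p
      simp only [wTerm]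
      ring
    · ring
  have := h.tsum_eq
  rw [wTerm_tsum 2 ht v h.summable] at this
  linear_combination -this / 2

lemma Jhalf_four {t : ℂ} (ht : t.re < 0) (v : ℂ) :
    Jth 4 (1 / 2) t v * Jth 0 (1 / 2) t v - 4 * (Jth 3 (1 / 2) t v * Jth 1 (1 / 2) t v)
      + 3 * Jth 2 (1 / 2) t v ^ 2
      = 8 * (Jth 0 0 (2 * t) (2 * v) * Jth 4 (1 / 2) (2 * t) 0
      + Jth 0 (1 / 2) (2 * t) (2 * v) * Jth 4 0 (2 * t) 0) := by
  have h : HasSum (wTerm 4 t v)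
      (2 * (Jth 4 (1 / 2) t v * Jth 0 (1 / 2) t v - 4 * (Jth 3 (1 / 2) t v * Jth 1 (1 / 2) t v)
      + 3 * Jth 2 (1 / 2) t v ^ 2)) := by
    have h40 := Jth_mul_tsum 4 0 (1 / 2) (1 / 2) ht ht v v
    have h04 := Jth_mul_tsum 0 4 (1 / 2) (1 / 2) ht ht v v
    have h31 := Jth_mul_tsum 3 1 (1 / 2) (1 / 2) ht ht v v
    have h13 := Jth_mul_tsum 1 3 (1 / 2) (1 / 2) ht ht v v
    have h22 := Jth_mul_tsum 2 2 (1 / 2) (1 / 2) ht ht v v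
    convert ((h40.add h04).sub ((h31.add h13).mul_left 4)).add (h22.mul_left 6) using 1
    · rfl
    · funext p
      simp only [wTerm]
      ring
    · ring
  have := h.tsum_eq
  rw [wTerm_tsum 4 ht v h.summable] at this
  linear_combination -this / 2


/-- The infinite `q`-Pochhammer symbol. -/
noncomputable def qp (x q : ℂ) : ℂ := ∏' m : ℕ, (1 - x * q ^ m)

lemma summable_qp (x : ℂ) {q : ℂ} (hq : ‖q‖ < 1) : Summable fun m : ℕ => ‖-(x * q ^ m)‖ := by
  simp only [norm_neg, norm_mul, norm_pow]
  exact (summable_geometric_of_lt_one (norm_nonneg _) hq).mul_left _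

lemma multipliable_qp (x : ℂ) {q : ℂ} (hq : ‖q‖ < 1) :
    Multipliable fun m : ℕ => (1 - x * q ^ m) := by
  simpa [sub_eq_add_neg] using multipliable_one_add_of_summable (summable_qp x hq)

lemma qp_tendsto (x : ℂ) {q : ℂ} (hq : ‖q‖ < 1) :
    Filter.Tendsto (fun N : ℕ => ∏ m ∈ range N, (1 - x * q ^ m)) Filter.atTop (nhds (qp x q)) :=
  (multipliable_qp x hq).hasProd.tendsto_prod_nat

lemma qp_ne_zero {x q : ℂ} (hq : ‖q‖ < 1) (h : ∀ m : ℕ, x * q ^ m ≠ 1) : qp x q ≠ 0 := by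
  have := tprod_one_add_ne_zero_of_summable (f := fun m : ℕ => -(x * q ^ m))
    (fun m => by
      rw [← sub_eq_add_neg, sub_ne_zero]; exact (h m).symm) (summable_qp x hq)
  simpa [qp, sub_eq_add_neg] using this

lemma qp_ne_zero' {x q : ℂ} (hq : ‖q‖ < 1) (hx : ‖x‖ < 1) : qp x q ≠ 0 := by
  refine qp_ne_zero hq fun m h => ?_
  have h1 : ‖x * q ^ m‖ = 1 := by rw [h]; simp
  rw [norm_mul, norm_pow] at h1
  have h2 : ‖q‖ ^ m ≤ 1 := pow_le_one₀ (norm_nonneg _) hq.le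
  nlinarith [norm_nonneg x, norm_nonneg q]

/-- Finite symbol. -/
noncomputable def poch (P : ℂ) (k : ℕ) : ℂ := ∏ i ∈ range k, (1 - P * P ^ i)

lemma poch_succ (P : ℂ) (k : ℕ) : poch P (k + 1) = poch P k * (1 - P ^ (k + 1)) := by
  rw [poch, prod_range_succ, poch, pow_succ']

lemma poch_ne_zero {P : ℂ} (hP : ‖P‖ < 1) (k : ℕ) : poch P k ≠ 0 := by
  rw [poch, prod_ne_zero_iff]
  intro i _ h
  have h1 : ‖P * P ^ i‖ = 1 := by rw [← sub_eq_zero.mp h]; simp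
  rw [norm_mul, norm_pow] at h1
  have h2 : ‖P‖ ^ i ≤ 1 := pow_le_one₀ (norm_nonneg _) hP.le
  nlinarith [norm_nonneg P]

/-- Reciprocal symbol on the integers. -/
noncomputable def rpoch (P : ℂ) (k : ℤ) : ℂ := if 0 ≤ k then (poch P k.toNat)⁻¹ else 0

lemma rpoch_pred {P : ℂ} (hP : ‖P‖ < 1) (k : ℤ) :
    rpoch P (k - 1) = (1 - P ^ k) * rpoch P k := by
  rcases lt_trichotomy k 0 with h | h | h
  · rw [rpoch, rpoch, if_neg (by omega), if_neg (by omega)]; simp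
  · subst h; simp [rpoch]
  · obtain ⟨j, rfl⟩ : ∃ j : ℕ, k = j + 1 := ⟨(k - 1).toNat, by omega⟩
    have e1 : ((j : ℤ) + 1 - 1).toNat = j := by omega
    have e2 : ((j : ℤ) + 1).toNat = j + 1 := by omega
    rw [rpoch, rpoch, if_pos (by omega), if_pos (by omega), e1, e2, poch_succ]
    have h1 := poch_ne_zero hP j
    have h2 := poch_ne_zero hP (j + 1)
    rw [poch_succ] at h2
    have h3 : (1 - P ^ (j + 1)) ≠ 0 := right_ne_zero_of_mul h2
    have : P ^ ((j : ℤ) + 1) = P ^ (j + 1) := by exact_mod_cast zpow_natCast P (j + 1)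
    rw [this]
    field_simp

lemma norm_exp_lt_one {t : ℂ} (ht : t.re < 0) : ‖Complex.exp t‖ < 1 := by
  rw [Complex.norm_exp]; simpa using ht

lemma finite_jtp {t : ℂ} (ht : t.re < 0) (u : ℂ) (N : ℕ) :
    HasSum (fun n : ℤ => Complex.exp (t * (n : ℂ) ^ 2 + n * u) *
      (poch (Complex.exp (2 * t)) (2 * N) * rpoch (Complex.exp (2 * t)) (N - n)
        * rpoch (Complex.exp (2 * t)) (N + n)))
      ((∏ m ∈ range N, (1 - (-Complex.exp (t + u)) * Complex.exp (2 * t) ^ m)) *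
        ∏ m ∈ range N, (1 - (-Complex.exp (t - u)) * Complex.exp (2 * t) ^ m)) := by
  have ht2 : (2 * t).re < 0 := by simp; linarith
  have hP := norm_exp_lt_one ht2
  have hP0 : Complex.exp (2 * t) ≠ 0 := Complex.exp_ne_zero _
  induction N with
  | zero =>
    have : ∀ n : ℤ, n ≠ 0 → Complex.exp (t * (n : ℂ) ^ 2 + n * u) *
      (poch (Complex.exp (2 * t)) (2 * 0) * rpoch (Complex.exp (2 * t)) ((0 : ℕ) - n)
        * rpoch (Complex.exp (2 * t)) ((0 : ℕ) + n)) = 0 := by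
      intro n hn
      rcases lt_or_gt_of_ne hn with h | h
      · simp [rpoch, h.not_ge]
      · simp [rpoch, h.not_ge]
    convert hasSum_single 0 this using 1
    simp [rpoch, poch]
  | succ N ih =>
    have s1 := (Equiv.subRight (1 : ℤ)).hasSum_iff.mpr ih
    have s2 := (Equiv.addRight (1 : ℤ)).hasSum_iff.mpr ih
    have := ((ih.mul_left (1 + Complex.exp (2 * t) ^ (2 * N + 1))).add
      (s1.mul_left (Complex.exp (t + u) * Complex.exp (2 * t) ^ N))).add
      (s2.mul_left (Complex.exp (t - u) * Complex.exp (2 * t) ^ N))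
    rw [prod_range_succ, prod_range_succ]
    convert this using 1
    · rfl
    · funext n
      simp only [Function.comp, Equiv.subRight_apply, Equiv.coe_addRight]
      have c1 : Complex.exp (t + u) * Complex.exp (2 * t) ^ N *
          Complex.exp (t * ((n - 1 : ℤ) : ℂ) ^ 2 + (n - 1 : ℤ) * u) =
          Complex.exp (t * (n : ℂ) ^ 2 + n * u) * Complex.exp (2 * t) ^ ((N : ℤ) + 1 - n) := by
        rw [← Complex.exp_nat_mul, ← Complex.exp_int_mul, ← Complex.exp_add, ← Complex.exp_add,
          ← Complex.exp_add]
        congr 1; push_cast; ring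
      have c2 : Complex.exp (t - u) * Complex.exp (2 * t) ^ N *
          Complex.exp (t * ((n + 1 : ℤ) : ℂ) ^ 2 + (n + 1 : ℤ) * u) =
          Complex.exp (t * (n : ℂ) ^ 2 + n * u) * Complex.exp (2 * t) ^ ((N : ℤ) + 1 + n) := by
        rw [← Complex.exp_nat_mul, ← Complex.exp_int_mul, ← Complex.exp_add, ← Complex.exp_add,
          ← Complex.exp_add]
        congr 1; push_cast; ring
      rw [← mul_assoc _ (Complex.exp (t * ((n - 1 : ℤ) : ℂ) ^ 2 + (n - 1 : ℤ) * u)), c1,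
        ← mul_assoc _ (Complex.exp (t * ((n + 1 : ℤ) : ℂ) ^ 2 + (n + 1 : ℤ) * u)), c2]
      generalize Complex.exp (2 * t) = P at *
      have r1 := rpoch_pred hP ((N : ℤ) + 1 - n)
      have r2 := rpoch_pred hP ((N : ℤ) + 1 + n)
      have r3 := rpoch_pred hP ((N : ℤ) + 1 - n - 1)
      have r4 := rpoch_pred hP ((N : ℤ) + 1 + n - 1)
      rw [zpow_sub_one₀ hP0] at r3 r4
      have hab : P ^ ((N : ℤ) + 1 - n) * P ^ ((N : ℤ) + 1 + n) = P ^ (2 * N + 2) := by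
        rw [← zpow_add₀ hP0, ← zpow_natCast]; congr 1; push_cast; ring
      have i1 : (N : ℤ) - n = N + 1 - n - 1 := by ring
      have i2 : (N : ℤ) + n = N + 1 + n - 1 := by ring
      have i3 : (N : ℤ) - (n - 1) = N + 1 - n := by ring
      have i4 : (N : ℤ) + (n - 1) = N + 1 + n - 1 - 1 := by ring
      have i5 : (N : ℤ) - (n + 1) = N + 1 - n - 1 - 1 := by ring
      have i6 : (N : ℤ) + (n + 1) = N + 1 + n := by ring
      have i7 : ((N + 1 : ℕ) : ℤ) = N + 1 := by push_cast; rfl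
      rw [i1, i2, i3, i4, i5, i6, i7, r3, r4, r1, r2]
      have p1 : poch P (2 * (N + 1)) = poch P (2 * N) * (1 - P ^ (2 * N + 1)) * (1 - P ^ (2 * N + 2)) := by
        rw [show 2 * (N + 1) = 2 * N + 1 + 1 by ring, poch_succ, poch_succ]
      rw [p1]
      have hM : P ^ (2 * N + 1) = P ^ ((N : ℤ) + 1 - n) * P ^ ((N : ℤ) + 1 + n) * P⁻¹ := by
        rw [hab, pow_succ P (2 * N + 1)]; field_simp
      rw [hM, ← hab]
      generalize P ^ ((N : ℤ) + 1 - n) = α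
      generalize P ^ ((N : ℤ) + 1 + n) = β
      ring
    · have e : Complex.exp (t + u) * Complex.exp (t - u) = Complex.exp (2 * t) := by
        rw [← Complex.exp_add]; congr 1; ring
      have e2 : Complex.exp (2 * t) ^ (2 * N + 1)
          = Complex.exp (t + u) * Complex.exp (t - u) * Complex.exp (2 * t) ^ N * Complex.exp (2 * t) ^ N := by
        rw [e]; ring
      rw [e2]
      ring

lemma rpoch_tendsto {P : ℂ} (hP : ‖P‖ < 1) :
    Filter.Tendsto (fun k : ℤ => rpoch P k) Filter.atTop (nhds (qp P P)⁻¹) := by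
  have h1 := (qp_tendsto P hP).inv₀ (qp_ne_zero' hP hP)
  have h2 : Filter.Tendsto Int.toNat Filter.atTop Filter.atTop :=
    Filter.tendsto_atTop.mpr fun b => Filter.eventually_atTop.mpr ⟨b, fun c hc => by omega⟩
  refine (h1.comp h2).congr' ?_
  filter_upwards [Filter.eventually_ge_atTop 0] with k hk
  simp [rpoch, hk, poch]

lemma rpoch_bdd {P : ℂ} (hP : ‖P‖ < 1) : ∃ C : ℝ, 0 ≤ C ∧ ∀ k, ‖rpoch P k‖ ≤ C := by
  have h1 := (qp_tendsto P hP).inv₀ (qp_ne_zero' hP hP)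
  obtain ⟨C, hC⟩ := (Metric.isBounded_range_of_tendsto _ h1).exists_norm_le
  have hC0 : 0 ≤ C := (norm_nonneg _).trans (hC _ ⟨0, rfl⟩)
  refine ⟨C, hC0, fun k => ?_⟩
  unfold rpoch
  split_ifs
  · exact hC _ ⟨k.toNat, rfl⟩
  · simpa using hC0

theorem jtp {t : ℂ} (ht : t.re < 0) (u : ℂ) :
    Jth 0 0 t u = qp (Complex.exp (2 * t)) (Complex.exp (2 * t)) *
      qp (-Complex.exp (t + u)) (Complex.exp (2 * t)) *
      qp (-Complex.exp (t - u)) (Complex.exp (2 * t)) := by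
  have ht2 : (2 * t).re < 0 := by simp; linarith
  have hP := norm_exp_lt_one ht2
  have hL := qp_ne_zero' hP hP
  set P := Complex.exp (2 * t) with hPd
  have hprod := (qp_tendsto (-Complex.exp (t + u)) hP).mul (qp_tendsto (-Complex.exp (t - u)) hP)
  obtain ⟨C, hC0, hC⟩ := rpoch_bdd hP
  obtain ⟨D, hD⟩ := (Metric.isBounded_range_of_tendsto _ (qp_tendsto P hP)).exists_norm_le
  have hD0 : 0 ≤ D := (norm_nonneg _).trans (hD _ ⟨0, rfl⟩)
  have hsum := summable_Jth_norm 0 0 ht u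
  have key := tendsto_tsum_of_dominated_convergence (𝓕 := (Filter.atTop : Filter ℕ))
    (f := fun (N : ℕ) (n : ℤ) => Complex.exp (t * (n : ℂ) ^ 2 + n * u) *
      (poch P (2 * N) * rpoch P (N - n) * rpoch P (N + n)))
    (g := fun n : ℤ => Complex.exp (t * (n : ℂ) ^ 2 + n * u) * (qp P P * (qp P P)⁻¹ * (qp P P)⁻¹))
    (bound := fun n : ℤ => ‖((n : ℂ) + (0 : ℝ)) ^ 0 * Complex.exp (t * ((n : ℂ) + (0 : ℝ)) ^ 2
      + ((n : ℂ) + (0 : ℝ)) * u)‖ * (D * C * C))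
    (hsum.mul_right _) ?_ ?_
  · have h2 : (fun N : ℕ => ∑' n : ℤ, Complex.exp (t * (n : ℂ) ^ 2 + n * u) *
      (poch P (2 * N) * rpoch P (N - n) * rpoch P (N + n))) = _ :=
      funext fun N => (finite_jtp ht u N).tsum_eq
    rw [h2] at key
    have h3 := tendsto_nhds_unique key hprod
    rw [tsum_mul_right] at h3
    have h4 : Jth 0 0 t u = ∑' n : ℤ, Complex.exp (t * (n : ℂ) ^ 2 + n * u) := by
      simp [Jth]
    rw [mul_assoc, ← h3, h4]
    field_simp
  · intro n
    refine Filter.Tendsto.mul tendsto_const_nhds ((Filter.Tendsto.mul ?_ ?_).mul ?_)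
    · exact (qp_tendsto P hP).comp
        (Filter.tendsto_atTop_mono (fun N => by omega : ∀ N : ℕ, N ≤ 2 * N) Filter.tendsto_id)
    · refine (rpoch_tendsto hP).comp (Filter.tendsto_atTop.mpr fun b =>
        Filter.eventually_atTop.mpr ⟨(b + n).toNat, fun c hc => by omega⟩)
    · refine (rpoch_tendsto hP).comp (Filter.tendsto_atTop.mpr fun b =>
        Filter.eventually_atTop.mpr ⟨(b - n).toNat, fun c hc => by omega⟩)
  · filter_upwards with N n
    rw [norm_mul, norm_mul, norm_mul]
    have := hC (N - n)
    have := hC (N + n)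
    have : ‖poch P (2 * N)‖ ≤ D := hD _ ⟨2 * N, rfl⟩
    have e : ((n : ℂ) + (0 : ℝ)) ^ 0 * Complex.exp (t * ((n : ℂ) + (0 : ℝ)) ^ 2
      + ((n : ℂ) + (0 : ℝ)) * u) = Complex.exp (t * (n : ℂ) ^ 2 + n * u) := by simp
    rw [e]
    gcongr


lemma hasSum_cg {ι : Type*} {f g : ι → ℂ} {a b : ℂ} (h : HasSum f a) (h1 : ∀ i, g i = f i)
    (h2 : b = a) : HasSum g b := by
  rw [h2, funext h1]; exact h

/-- Lambert type terms. -/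
noncomputable def lterm (k : ℕ) (t u : ℂ) (p : ℕ × ℕ) : ℂ :=
  ((p.2 : ℂ) + 1) ^ k / ((p.2 : ℂ) + 1) *
    Complex.exp (((p.2 : ℂ) + 1) * (((p.1 : ℂ) + 1) * t + u))

/-- Lambert type series `∑ d^{k-1} q^{md} e^{du}`. -/
noncomputable def Lam (k : ℕ) (t u : ℂ) : ℂ := ∑' p : ℕ × ℕ, lterm k t u p

/-- Bound. -/
noncomputable def lbound (k : ℕ) (r L : ℝ) (p : ℕ × ℕ) : ℝ :=
  Real.exp r ^ p.1 * (((p.2 + 1 : ℕ) : ℝ) ^ k * Real.exp (r + L) ^ (p.2 + 1))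

lemma summable_lbound (k : ℕ) {r L : ℝ} (hr : r < 0) (hL : r + L < 0) :
    Summable (lbound k r L) := by
  have h1 : Summable fun n : ℕ => Real.exp r ^ n :=
    summable_geometric_of_lt_one (Real.exp_pos _).le (by simpa using hr)
  have h2 : Summable fun n : ℕ => ((n + 1 : ℕ) : ℝ) ^ k * Real.exp (r + L) ^ (n + 1) := by
    have := summable_pow_mul_geometric_of_norm_lt_one k (r := Real.exp (r + L))
      (by rw [Real.norm_eq_abs, abs_of_pos (Real.exp_pos _)]; simpa using hL)
    exact (summable_nat_add_iff 1).mpr this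
  exact h1.mul_of_nonneg h2 (fun n => by positivity) (fun n => by positivity)

lemma norm_lterm_le (k : ℕ) {t u : ℂ} {L : ℝ} (ht : t.re < 0) (hu : u.re ≤ L) (p : ℕ × ℕ) :
    ‖lterm k t u p‖ ≤ lbound k t.re L p := by
  obtain ⟨m, d⟩ := p
  simp only [lterm, lbound]
  have e : ((d : ℂ) + 1) = (((d + 1 : ℕ) : ℝ) : ℂ) := by push_cast; rfl
  have e' : ((m : ℂ) + 1) = (((m + 1 : ℕ) : ℝ) : ℂ) := by push_cast; rfl
  rw [e, e', norm_mul, norm_div, norm_pow, Complex.norm_real, Complex.norm_exp, Real.norm_eq_abs,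
    abs_of_nonneg (by positivity), Complex.re_ofReal_mul, Complex.add_re, Complex.re_ofReal_mul,
    ← Real.exp_nat_mul, ← Real.exp_nat_mul]
  have h1 : ((d + 1 : ℕ) : ℝ) ^ k / ((d + 1 : ℕ) : ℝ) ≤ ((d + 1 : ℕ) : ℝ) ^ k :=
    div_le_self (by positivity) (by push_cast; linarith [Nat.cast_nonneg (α := ℝ) d])
  have h2 : ((d + 1 : ℕ) : ℝ) * (((m + 1 : ℕ) : ℝ) * t.re + u.re) ≤
      m * t.re + ((d + 1 : ℕ) : ℝ) * (t.re + L) := by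
    push_cast
    have hd : (0 : ℝ) ≤ d := Nat.cast_nonneg d
    have hm : (0 : ℝ) ≤ m := Nat.cast_nonneg m
    have := mul_le_mul_of_nonneg_left hu (by linarith : (0 : ℝ) ≤ (d : ℝ) + 1)
    have := mul_nonneg (mul_nonneg hd hm) (by linarith : 0 ≤ -t.re)
    nlinarith
  calc _ ≤ ((d + 1 : ℕ) : ℝ) ^ k * Real.exp (m * t.re + ((d + 1 : ℕ) : ℝ) * (t.re + L)) := by
        gcongr
    _ = _ := by rw [Real.exp_add]; ring

lemma summable_lterm (k : ℕ) {t u : ℂ} (ht : t.re < 0) (hu : t.re + u.re < 0) :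
    Summable (lterm k t u) :=
  Summable.of_norm_bounded (summable_lbound k ht hu) (norm_lterm_le k ht le_rfl)

lemma Lam_hasDerivAt (k : ℕ) {t u : ℂ} (ht : t.re < 0) (hu : t.re + u.re < 0) :
    HasDerivAt (fun u => Lam k t u) (Lam (k + 1) t u) u := by
  obtain ⟨L, hL1, hL2⟩ : ∃ L, u.re < L ∧ L < -t.re := exists_between (by linarith)
  refine hasDerivAt_tsum_of_isPreconnected (t := {c : ℂ | c.re < L}) (y₀ := u) 
    (summable_lbound (k + 1) ht (by linarith : t.re + L < 0))
    (isOpen_lt (by fun_prop) (by fun_prop)) (convex_halfSpace_re_lt L).isPreconnected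
    (g := fun p u => lterm k t u p) (g' := fun p u => lterm (k + 1) t u p) ?_ ?_ hL1
    (summable_lterm k ht hu) hL1
  · intro p y hy
    unfold lterm
    have := (((hasDerivAt_id y).const_add (((p.1 : ℂ) + 1) * t)).const_mul
      ((p.2 : ℂ) + 1)).cexp.const_mul (((p.2 : ℂ) + 1) ^ k / ((p.2 : ℂ) + 1))
    refine this.congr_deriv ?_
    simp only [id]
    ring
  · intro p y hy
    exact norm_lterm_le (k + 1) ht (le_of_lt hy) p

lemma qp_eq_exp {t u : ℂ} (ht : t.re < 0) (hu : t.re + u.re < 0) :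
    qp (Complex.exp (t + u)) (Complex.exp t) = Complex.exp (-Lam 0 t u) := by
  have h1 := (summable_lterm 0 ht hu).hasSum.neg
  have hn : ∀ m : ℕ, ‖Complex.exp (((m : ℂ) + 1) * t + u)‖ < 1 := by
    intro m
    apply norm_exp_lt_one
    have : (((m : ℂ) + 1) * t + u).re = ((m : ℝ) + 1) * t.re + u.re := by
      simp
    rw [this]
    have := mul_nonneg (Nat.cast_nonneg (α := ℝ) m) (by linarith : 0 ≤ -t.re)
    linarith
  have h2 : ∀ m : ℕ, HasSum (fun d : ℕ => -lterm 0 t u (m, d))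
      (Complex.log (1 - Complex.exp (((m : ℂ) + 1) * t + u))) := by
    intro m
    have h := (Complex.hasSum_taylorSeries_neg_log (hn m)).neg
    rw [neg_neg, ← hasSum_nat_add_iff' 1] at h
    simp only [range_one, sum_singleton] at h
    refine hasSum_cg h ?_ ?_
    · intro d
      simp only [lterm]
      rw [← Complex.exp_nat_mul]
      push_cast
      ring
    · simp
  have h3 := (h1.prod_fiberwise h2).cexp
  have h4 : (Complex.exp ∘ fun m : ℕ => Complex.log (1 - Complex.exp (((m : ℂ) + 1) * t + u)))
      = fun m : ℕ => 1 - Complex.exp (t + u) * Complex.exp t ^ m := by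
    funext m
    simp only [Function.comp]
    rw [Complex.exp_log, ← Complex.exp_nat_mul, ← Complex.exp_add]
    · congr 2; ring
    · intro h
      have := hn m
      rw [← sub_eq_zero.mp h] at this
      simp at this
  rw [h4] at h3
  exact h3.tprod_eq

/-- The odd theta function. -/
noncomputable def Th (k : ℕ) (t u : ℂ) : ℂ := Jth k (1 / 2) (t / 2) (u + π * Complex.I)

lemma Th_hasDerivAt (k : ℕ) {t : ℂ} (ht : t.re < 0) (u : ℂ) :
    HasDerivAt (fun u => Th k t u) (Th (k + 1) t u) u := by
  have := (Jth_hasDerivAt_u k (1 / 2) (t := t / 2) (by simp; linarith) (u + π * Complex.I))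
  exact this.comp_add_const u (π * Complex.I)

lemma qp_step (x : ℂ) {q : ℂ} (hq : ‖q‖ < 1) : qp x q = (1 - x) * qp (x * q) q := by
  rw [qp, tprod_eq_zero_mul' ?_]
  · simp [qp, pow_succ', mul_assoc]
  · simpa [pow_succ', mul_assoc] using multipliable_qp (x * q) hq

lemma Th_zero_eq {t : ℂ} (ht : t.re < 0) {u : ℂ} (hu : |u.re| < -t.re) :
    Th 0 t u = Complex.I * Complex.exp (t / 8) * qp (Complex.exp t) (Complex.exp t) *
      ((Complex.exp (u / 2) - Complex.exp (-(u / 2))) * Complex.exp (-Lam 0 t u - Lam 0 t (-u))) := by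
  have hq := norm_exp_lt_one ht
  have h1 : t.re + u.re < 0 := by linarith [le_abs_self u.re]
  have h2 : t.re + (-u).re < 0 := by simp; linarith [neg_abs_le u.re]
  rw [Th, Jth_half_eq, jtp (by simp; linarith)]
  have e0 : 2 * (t / 2) = t := by ring
  have e1 : -Complex.exp (t / 2 + (u + π * Complex.I + t / 2)) = Complex.exp (t + u) := by
    rw [show t / 2 + (u + π * Complex.I + t / 2) = t + u + π * Complex.I by ring, Complex.exp_add,
      Complex.exp_pi_mul_I]; ring
  have e2 : -Complex.exp (t / 2 - (u + π * Complex.I + t / 2)) = Complex.exp (-u) := by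
    rw [show t / 2 - (u + π * Complex.I + t / 2) = -u - π * Complex.I by ring, Complex.exp_sub,
      Complex.exp_pi_mul_I]; ring
  rw [e0, e1, e2, qp_step (Complex.exp (-u)) hq, ← Complex.exp_add, add_comm (-u) t,
    qp_eq_exp ht h1, qp_eq_exp ht h2]
  have e3 : Complex.exp (t / 2 / 4 + (u + π * Complex.I) / 2) =
      Complex.I * Complex.exp (t / 8) * Complex.exp (u / 2) := by
    rw [show t / 2 / 4 + (u + π * Complex.I) / 2 = t / 8 + u / 2 + π / 2 * Complex.I by ring,
      Complex.exp_add, Complex.exp_add, Complex.exp_pi_div_two_mul_I]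
    ring
  have e4 : Complex.exp (u / 2) * Complex.exp (-u) = Complex.exp (-(u / 2)) := by
    rw [← Complex.exp_add]; congr 1; ring
  rw [e3, sub_eq_add_neg (-Lam 0 t u), Complex.exp_add (-Lam 0 t u), ← e4]
  ring

/-- Hyperbolic cotangent. -/
noncomputable def sg (u : ℂ) : ℂ := (1 / 2) * ((Complex.exp u + 1) / (Complex.exp u - 1))

lemma sg_hasDerivAt {u : ℂ} (hu : Complex.exp u ≠ 1) :
    HasDerivAt sg (1 / 4 - sg u ^ 2) u := by
  have h0 : Complex.exp u - 1 ≠ 0 := sub_ne_zero.mpr hu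
  have := ((((Complex.hasDerivAt_exp u).add_const 1).div
    ((Complex.hasDerivAt_exp u).sub_const 1) h0).const_mul (1 / 2 : ℂ))
  refine HasDerivAt.congr_deriv this ?_
  rw [sg]
  field_simp
  ring

lemma Lam_hasDerivAt_neg (k : ℕ) {t u : ℂ} (ht : t.re < 0) (hu : t.re - u.re < 0) :
    HasDerivAt (fun u => Lam k t (-u)) (-Lam (k + 1) t (-u)) u := by
  have := (Lam_hasDerivAt k (u := -u) ht (by simpa using hu)).comp u (hasDerivAt_neg u)
  simpa [Function.comp_def] using this

/-- Logarithmic derivatives. -/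
noncomputable def S0 (t u : ℂ) : ℂ := sg u - (Lam 1 t u - Lam 1 t (-u))
/-- Logarithmic derivatives. -/
noncomputable def S1 (t u : ℂ) : ℂ := (1 / 4 - sg u ^ 2) - (Lam 2 t u + Lam 2 t (-u))
/-- Logarithmic derivatives. -/
noncomputable def S2 (t u : ℂ) : ℂ := -2 * sg u * (1 / 4 - sg u ^ 2) - (Lam 3 t u - Lam 3 t (-u))
/-- Logarithmic derivatives. -/
noncomputable def S3 (t u : ℂ) : ℂ := (-2 * (1 / 4 - sg u ^ 2) ^ 2 + 4 * sg u ^ 2 * (1 / 4 - sg u ^ 2))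
  - (Lam 4 t u + Lam 4 t (-u))

/-- The domain. -/
def dom (t : ℂ) : Set ℂ := {u | |u.re| < -t.re ∧ Complex.exp u ≠ 1}

lemma dom_open (t : ℂ) : IsOpen (dom t) := by
  have h1 : IsOpen {u : ℂ | |u.re| < -t.re} := isOpen_lt (by fun_prop) (by fun_prop)
  have h2 : IsOpen {u : ℂ | Complex.exp u ≠ 1} := isOpen_ne_fun (by fun_prop) (by fun_prop)
  exact h1.inter h2

lemma dom_re {t u : ℂ} (hu : |u.re| < -t.re) : t.re + u.re < 0 ∧ t.re - u.re < 0 :=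
  ⟨by linarith [le_abs_self u.re], by linarith [neg_abs_le u.re]⟩

lemma S0_hasDerivAt {t u : ℂ} (ht : t.re < 0) (hu : u ∈ dom t) :
    HasDerivAt (fun u => S0 t u) (S1 t u) u := by
  obtain ⟨h1, h2⟩ := hu
  obtain ⟨h3, h4⟩ := dom_re h1
  have := (sg_hasDerivAt h2).sub ((Lam_hasDerivAt 1 ht h3).sub (Lam_hasDerivAt_neg 1 ht h4))
  refine HasDerivAt.congr_deriv this ?_
  rw [S1]; ring

lemma S1_hasDerivAt {t u : ℂ} (ht : t.re < 0) (hu : u ∈ dom t) :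
    HasDerivAt (fun u => S1 t u) (S2 t u) u := by
  obtain ⟨h1, h2⟩ := hu
  obtain ⟨h3, h4⟩ := dom_re h1
  have := (((sg_hasDerivAt h2).pow 2).const_sub (1 / 4)).sub
    ((Lam_hasDerivAt 2 ht h3).add (Lam_hasDerivAt_neg 2 ht h4))
  refine HasDerivAt.congr_deriv this ?_
  rw [S2]; push_cast; ring

lemma S2_hasDerivAt {t u : ℂ} (ht : t.re < 0) (hu : u ∈ dom t) :
    HasDerivAt (fun u => S2 t u) (S3 t u) u := by
  obtain ⟨h1, h2⟩ := hu
  obtain ⟨h3, h4⟩ := dom_re h1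
  have := (((sg_hasDerivAt h2).const_mul (-2)).mul
    (((sg_hasDerivAt h2).pow 2).const_sub (1 / 4))).sub
    ((Lam_hasDerivAt 3 ht h3).sub (Lam_hasDerivAt_neg 3 ht h4))
  refine HasDerivAt.congr_deriv this ?_
  rw [S3]; push_cast; simp only [Pi.pow_apply]; ring

lemma Th_one_eq {t u : ℂ} (ht : t.re < 0) (hu : u ∈ dom t) : Th 1 t u = S0 t u * Th 0 t u := by
  obtain ⟨h1, h2⟩ := hu
  obtain ⟨h3, h4⟩ := dom_re h1
  have ha := Th_hasDerivAt 0 ht u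
  have hb : HasDerivAt (fun u => Complex.I * Complex.exp (t / 8) * qp (Complex.exp t) (Complex.exp t) *
      ((Complex.exp (u / 2) - Complex.exp (-(u / 2))) * Complex.exp (-Lam 0 t u - Lam 0 t (-u)))) _ u :=
    (((((hasDerivAt_id u).div_const 2).cexp).sub
      ((((hasDerivAt_id u).div_const 2).neg).cexp)).mul
      (((Lam_hasDerivAt 0 ht h3).neg.sub (Lam_hasDerivAt_neg 0 ht h4)).cexp)).const_mul _
  have hopen : IsOpen {u : ℂ | |u.re| < -t.re} := isOpen_lt (by fun_prop) (by fun_prop)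
  have hc := hb.congr_of_eventuallyEq (f₁ := fun u => Th 0 t u) (by
    filter_upwards [hopen.mem_nhds h1] with w hw using Th_zero_eq ht hw)
  rw [ha.unique hc, Th_zero_eq ht h1, S0]
  simp only [id]
  have hs : sg u * (Complex.exp (u / 2) - Complex.exp (-(u / 2)))
      = (1 / 2) * (Complex.exp (u / 2) + Complex.exp (-(u / 2))) := by
    rw [sg]
    have e1 : Complex.exp u = Complex.exp (u / 2) ^ 2 := by
      rw [← Complex.exp_nat_mul]; congr 1; push_cast; ring
    have e2 : Complex.exp (-(u / 2)) = (Complex.exp (u / 2))⁻¹ := Complex.exp_neg _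
    have h0 : Complex.exp u - 1 ≠ 0 := sub_ne_zero.mpr h2
    have h5 := Complex.exp_ne_zero (u / 2)
    rw [e1] at h0 ⊢
    rw [e2]
    field_simp
  simp only [Pi.sub_apply, Pi.neg_apply]
  linear_combination (-Complex.I * Complex.exp (t / 8) * qp (Complex.exp t) (Complex.exp t) *
    Complex.exp (-Lam 0 t u - Lam 0 t (-u))) * hs

lemma Th_zero_ne {t u : ℂ} (ht : t.re < 0) (hu : u ∈ dom t) : Th 0 t u ≠ 0 := by
  have hq := norm_exp_lt_one ht
  rw [Th_zero_eq ht hu.1]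
  refine mul_ne_zero (mul_ne_zero (mul_ne_zero Complex.I_ne_zero (Complex.exp_ne_zero _))
    (qp_ne_zero' hq hq)) (mul_ne_zero ?_ (Complex.exp_ne_zero _))
  intro h
  apply hu.2
  have e1 : Complex.exp u = Complex.exp (u / 2) * Complex.exp (u / 2) := by
    rw [← Complex.exp_add]; congr 1; ring
  rw [e1]
  nth_rewrite 2 [sub_eq_zero.mp h]
  rw [← Complex.exp_add]; simp

lemma Th_two_eq {t u : ℂ} (ht : t.re < 0) (hu : u ∈ dom t) :
    Th 2 t u = S1 t u * Th 0 t u + S0 t u * Th 1 t u := by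
  have h := ((S0_hasDerivAt ht hu).mul (Th_hasDerivAt 0 ht u)).congr_of_eventuallyEq
    (f₁ := fun u => Th 1 t u) (by
    filter_upwards [(dom_open t).mem_nhds hu] with w hw using Th_one_eq ht hw)
  exact (Th_hasDerivAt 1 ht u).unique h

lemma Th_three_eq {t u : ℂ} (ht : t.re < 0) (hu : u ∈ dom t) :
    Th 3 t u = S2 t u * Th 0 t u + 2 * S1 t u * Th 1 t u + S0 t u * Th 2 t u := by
  have h := (((S1_hasDerivAt ht hu).mul (Th_hasDerivAt 0 ht u)).add
    ((S0_hasDerivAt ht hu).mul (Th_hasDerivAt 1 ht u))).congr_of_eventuallyEq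
    (f₁ := fun u => Th 2 t u) (by
    filter_upwards [(dom_open t).mem_nhds hu] with w hw using Th_two_eq ht hw)
  rw [(Th_hasDerivAt 2 ht u).unique h]; ring

lemma Th_four_eq {t u : ℂ} (ht : t.re < 0) (hu : u ∈ dom t) :
    Th 4 t u = S3 t u * Th 0 t u + 3 * S2 t u * Th 1 t u + 3 * S1 t u * Th 2 t u
      + S0 t u * Th 3 t u := by
  have h := ((((S2_hasDerivAt ht hu).mul (Th_hasDerivAt 0 ht u)).add
    (((S1_hasDerivAt ht hu).const_mul 2).mul (Th_hasDerivAt 1 ht u))).add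
    ((S0_hasDerivAt ht hu).mul (Th_hasDerivAt 2 ht u))).congr_of_eventuallyEq
    (f₁ := fun u => Th 3 t u) (by
    filter_upwards [(dom_open t).mem_nhds hu] with w hw using Th_three_eq ht hw)
  rw [(Th_hasDerivAt 3 ht u).unique h]; ring

lemma Th_sq {t : ℂ} (ht : t.re < 0) (u : ℂ) :
    Th 0 t u ^ 2 = Jth 0 0 t (2 * u) * Jth 0 (1 / 2) t 0 - Jth 0 (1 / 2) t (2 * u) * Jth 0 0 t 0 := by
  rw [Th, Jhalf_sq (by simp; linarith), show 2 * (t / 2) = t by ring,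
    show 2 * (u + π * Complex.I) = 2 * u + 2 * π * Complex.I by ring, Jth_zero_add_two_pi,
    Jth_half_add_two_pi]
  ring

lemma S1_eq {t u : ℂ} (ht : t.re < 0) (hu : u ∈ dom t) :
    S1 t u * Th 0 t u ^ 2 = 2 * (Jth 0 0 t (2 * u) * Jth 2 (1 / 2) t 0
      - Jth 0 (1 / 2) t (2 * u) * Jth 2 0 t 0) := by
  have h := Jhalf_two (t := t / 2) (by simp; linarith) (u + π * Complex.I)
  rw [show 2 * (t / 2) = t by ring,
    show 2 * (u + π * Complex.I) = 2 * u + 2 * π * Complex.I by ring, Jth_zero_add_two_pi,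
    Jth_half_add_two_pi] at h
  have h0 := Th_one_eq ht hu
  have h1 := Th_two_eq ht hu
  change Th 2 t u * Th 0 t u - Th 1 t u ^ 2 = _ at h
  rw [h1] at h
  linear_combination h + Th 1 t u * h0

lemma S3_eq {t u : ℂ} (ht : t.re < 0) (hu : u ∈ dom t) :
    (S3 t u + 6 * S1 t u ^ 2) * Th 0 t u ^ 2 = 8 * (Jth 0 0 t (2 * u) * Jth 4 (1 / 2) t 0
      - Jth 0 (1 / 2) t (2 * u) * Jth 4 0 t 0) := by
  have h := Jhalf_four (t := t / 2) (by simp; linarith) (u + π * Complex.I)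
  rw [show 2 * (t / 2) = t by ring,
    show 2 * (u + π * Complex.I) = 2 * u + 2 * π * Complex.I by ring, Jth_zero_add_two_pi,
    Jth_half_add_two_pi] at h
  have h0 := Th_one_eq ht hu
  have h1 := Th_two_eq ht hu
  have h2 := Th_three_eq ht hu
  have h3 := Th_four_eq ht hu
  change Th 4 t u * Th 0 t u - 4 * (Th 3 t u * Th 1 t u) + 3 * Th 2 t u ^ 2 = _ at h
  rw [h3, h2, h1, h0] at h
  linear_combination h

lemma wronskian {t : ℂ} (ht : t.re < 0) :
    Jth 0 0 t 0 * Jth 2 (1 / 2) t 0 - Jth 0 (1 / 2) t 0 * Jth 2 0 t 0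
      = (1 / 2) * Complex.exp (t / 4) * qp (Complex.exp t) (Complex.exp t) ^ 6 := by
  have h := Jhalf_two (t := t / 2) (by simp; linarith) (0 + π * Complex.I)
  rw [show 2 * (t / 2) = t by ring,
    show 2 * (0 + π * Complex.I) = 0 + 2 * π * Complex.I by ring, Jth_zero_add_two_pi,
    Jth_half_add_two_pi] at h
  change Th 2 t 0 * Th 0 t 0 - Th 1 t 0 ^ 2 = _ at h
  have h1 : |(0 : ℂ).re| < -t.re := by simp; linarith
  have h0 : Th 0 t 0 = 0 := by rw [Th_zero_eq ht h1]; simp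
  obtain ⟨h3, h4⟩ := dom_re h1
  have ha := Th_hasDerivAt 0 ht 0
  have hb : HasDerivAt (fun u => Complex.I * Complex.exp (t / 8) * qp (Complex.exp t) (Complex.exp t) *
      ((Complex.exp (u / 2) - Complex.exp (-(u / 2))) * Complex.exp (-Lam 0 t u - Lam 0 t (-u)))) _ 0 :=
    (((((hasDerivAt_id 0).div_const 2).cexp).sub
      ((((hasDerivAt_id 0).div_const 2).neg).cexp)).mul
      (((Lam_hasDerivAt 0 ht h3).neg.sub (Lam_hasDerivAt_neg 0 ht h4)).cexp)).const_mul _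
  have hopen : IsOpen {u : ℂ | |u.re| < -t.re} := isOpen_lt (by fun_prop) (by fun_prop)
  have hc := hb.congr_of_eventuallyEq (f₁ := fun u => Th 0 t u) (by
    filter_upwards [hopen.mem_nhds h1] with w hw using Th_zero_eq ht hw)
  have h5 := ha.unique hc
  have h6 : Complex.exp (-Lam 0 t 0 - Lam 0 t 0) = qp (Complex.exp t) (Complex.exp t) ^ 2 := by
    have := qp_eq_exp ht h3
    rw [add_zero] at this
    rw [this, ← Complex.exp_nat_mul]; congr 1; push_cast; ring
  simp only [Pi.sub_apply, Pi.neg_apply, zero_div, neg_zero, Complex.exp_zero, h6] at h5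
  have h7 : Complex.exp (t / 8) ^ 2 = Complex.exp (t / 4) := by
    rw [← Complex.exp_nat_mul]; congr 1; push_cast; ring
  rw [h0, h5] at h
  rw [← h7]
  have hI := Complex.I_sq
  linear_combination -h / 2 - (1 / 2) * Complex.exp (t / 8) ^ 2 * qp (Complex.exp t) (Complex.exp t) ^ 6 * hI


lemma qp_split (x : ℂ) {q : ℂ} (hq : ‖q‖ < 1) : qp x q = qp x (q ^ 2) * qp (x * q) (q ^ 2) := by
  have hq2 : ‖q ^ 2‖ < 1 := by rw [norm_pow]; exact pow_lt_one₀ (norm_nonneg _) hq two_ne_zero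
  have h1 := multipliable_qp x hq2
  have h2 := multipliable_qp (x * q) hq2
  rw [qp, qp, qp]
  have e1 : (fun m : ℕ => 1 - x * (q ^ 2) ^ m) = fun m : ℕ => 1 - x * q ^ (2 * m) := by
    funext m; rw [pow_mul]
  have e2 : (fun m : ℕ => 1 - x * q * (q ^ 2) ^ m) = fun m : ℕ => 1 - x * q ^ (2 * m + 1) := by
    funext m; ring
  rw [e1] at h1 ⊢
  rw [e2] at h2 ⊢
  exact (tprod_even_mul_odd (f := fun m : ℕ => 1 - x * q ^ m) h1 h2).symm

lemma qp_mul_neg (x : ℂ) {q : ℂ} (hq : ‖q‖ < 1) : qp x q * qp (-x) q = qp (x ^ 2) (q ^ 2) := by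
  rw [qp, qp, qp, ← (multipliable_qp x hq).tprod_mul (multipliable_qp (-x) hq)]
  refine tprod_congr fun m => ?_
  ring

/-- Euler function. -/
noncomputable def Eu (t : ℂ) : ℂ := qp (Complex.exp t) (Complex.exp t)

lemma exp_two (t : ℂ) : Complex.exp (2 * t) = Complex.exp t ^ 2 := by
  rw [← Complex.exp_nat_mul]; push_cast; rfl

lemma Eu_ne {t : ℂ} (ht : t.re < 0) : Eu t ≠ 0 :=
  qp_ne_zero' (norm_exp_lt_one ht) (norm_exp_lt_one ht)

lemma re_two {t : ℂ} (ht : t.re < 0) : (2 * t).re < 0 := by simp; linarith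
lemma re_four {t : ℂ} (ht : t.re < 0) : (4 * t).re < 0 := by simp; linarith
lemma re_eight {t : ℂ} (ht : t.re < 0) : (8 * t).re < 0 := by simp; linarith

/-- Odd products. -/
lemma Od_eq {t : ℂ} (ht : t.re < 0) :
    qp (Complex.exp t) (Complex.exp (2 * t)) * Eu (2 * t) = Eu t := by
  rw [Eu, Eu, qp_split _ (norm_exp_lt_one ht), exp_two]
  congr 2; ring

lemma Op_eq {t : ℂ} (ht : t.re < 0) :
    qp (-Complex.exp t) (Complex.exp (2 * t)) * Eu t * Eu (4 * t) = Eu (2 * t) ^ 2 := by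
  have h1 := Od_eq ht
  have h2 := Od_eq (re_two ht)
  have h3 := qp_mul_neg (Complex.exp t) (norm_exp_lt_one (re_two ht))
  rw [← exp_two, ← exp_two] at h3
  rw [show 2 * (2 * t) = 4 * t by ring] at h2 h3
  rw [← h1]
  calc _ = (qp (Complex.exp t) (Complex.exp (2 * t)) * qp (-Complex.exp t) (Complex.exp (2 * t)))
        * Eu (4 * t) * Eu (2 * t) := by ring
    _ = _ := by rw [h3, h2]; ring

lemma Ep_eq {t : ℂ} (ht : t.re < 0) :
    qp (-Complex.exp t) (Complex.exp t) * Eu t = Eu (2 * t) := by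
  have h3 := qp_mul_neg (Complex.exp t) (norm_exp_lt_one ht)
  rw [← exp_two] at h3
  rw [Eu, Eu, ← h3, mul_comm]

/-- `φ(q)` -/
noncomputable def th3 (t : ℂ) : ℂ := Jth 0 0 t 0
/-- `φ(-q)` -/
noncomputable def th4 (t : ℂ) : ℂ := Jth 0 0 t (π * Complex.I)
/-- `θ₂(q)` -/
noncomputable def th2 (t : ℂ) : ℂ := Jth 0 (1 / 2) t 0

lemma th3_eq {t : ℂ} (ht : t.re < 0) : th3 t * (Eu t ^ 2 * Eu (4 * t) ^ 2) = Eu (2 * t) ^ 5 := by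
  have h := Op_eq ht
  rw [th3, jtp ht, add_zero, sub_zero]
  change Eu (2 * t) * _ * _ * _ = _
  linear_combination Eu (2 * t) * (qp (-Complex.exp t) (Complex.exp (2 * t)) * Eu t * Eu (4 * t) +
    Eu (2 * t) ^ 2) * h

lemma th4_eq {t : ℂ} (ht : t.re < 0) : th4 t * Eu (2 * t) = Eu t ^ 2 := by
  have h := Od_eq ht
  have e1 : -Complex.exp (t + π * Complex.I) = Complex.exp t := by
    rw [Complex.exp_add, Complex.exp_pi_mul_I]; ring
  have e2 : -Complex.exp (t - π * Complex.I) = Complex.exp t := by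
    rw [Complex.exp_sub, Complex.exp_pi_mul_I]; ring
  rw [th4, jtp ht, e1, e2, ← h]
  change Eu (2 * t) * _ * _ * _ = _
  ring

lemma th2_eq {t : ℂ} (ht : t.re < 0) :
    th2 t * Eu (2 * t) = 2 * Complex.exp (t / 4) * Eu (4 * t) ^ 2 := by
  have h := Ep_eq (re_two ht)
  rw [show 2 * (2 * t) = 4 * t by ring] at h
  rw [th2, Jth_half_eq, zero_div, add_zero, zero_add, jtp ht, ← two_mul, sub_self, Complex.exp_zero,
    qp_step (-1) (norm_exp_lt_one (re_two ht)), neg_one_mul, ← h]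
  change _ * (Eu (2 * t) * _ * _) * _ = _
  ring

lemma th3_ne {t : ℂ} (ht : t.re < 0) : th3 t ≠ 0 := by
  intro h
  have := th3_eq ht
  rw [h, zero_mul] at this
  exact pow_ne_zero _ (Eu_ne (re_two ht)) this.symm

lemma th4_ne {t : ℂ} (ht : t.re < 0) : th4 t ≠ 0 := by
  intro h
  have := th4_eq ht
  rw [h, zero_mul] at this
  exact pow_ne_zero _ (Eu_ne ht) this.symm

lemma th2_ne {t : ℂ} (ht : t.re < 0) : th2 t ≠ 0 := by
  intro h
  have := th2_eq ht
  rw [h, zero_mul] at this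
  exact mul_ne_zero (mul_ne_zero two_ne_zero (Complex.exp_ne_zero _))
    (pow_ne_zero _ (Eu_ne (re_four ht))) this.symm

lemma wronskian' {t : ℂ} (ht : t.re < 0) :
    th3 t * Jth 2 (1 / 2) t 0 - th2 t * Jth 2 0 t 0 = (1 / 4) * (th3 t * th2 t * th4 t ^ 4) := by
  have h := wronskian ht
  change th3 t * _ - th2 t * _ = _ * Eu t ^ 6 at h
  rw [h]
  have h1 := Eu_ne ht
  have h2 := Eu_ne (re_two ht)
  have h4 := Eu_ne (re_four ht)
  have e3 : th3 t = Eu (2 * t) ^ 5 / (Eu t ^ 2 * Eu (4 * t) ^ 2) := by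
    rw [eq_div_iff (by positivity), th3_eq ht]
  have e4 : th4 t = Eu t ^ 2 / Eu (2 * t) := by rw [eq_div_iff h2, th4_eq ht]
  have e2 : th2 t = 2 * Complex.exp (t / 4) * Eu (4 * t) ^ 2 / Eu (2 * t) := by
    rw [eq_div_iff h2, th2_eq ht]
  rw [e2, e3, e4]
  generalize Eu (4 * t) = E4 at *
  generalize Eu (2 * t) = E2 at *
  field_simp
  ring

lemma th3_shift (t : ℂ) : th3 (t + π * Complex.I) = th4 t := by
  rw [th3, Jth_zero_shift, zero_add]; rfl
lemma th4_shift (t : ℂ) : th4 (t + π * Complex.I) = th3 t := by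
  rw [th4, Jth_zero_shift, show (π : ℂ) * Complex.I + π * Complex.I = 0 + 2 * π * Complex.I by ring,
    Jth_zero_add_two_pi]; rfl
lemma th2_shift (t : ℂ) : th2 (t + π * Complex.I) = Complex.exp (π * Complex.I / 4) * th2 t := by
  rw [th2, Jth_half_shift]; rfl

lemma wronskian4 {t : ℂ} (ht : t.re < 0) :
    th4 t * Jth 2 (1 / 2) t 0 - th2 t * Jth 2 0 t (π * Complex.I)
      = (1 / 4) * (th4 t * th2 t * th3 t ^ 4) := by
  have h := wronskian' (t := t + π * Complex.I) (by simpa using ht)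
  rw [th3_shift, th4_shift, th2_shift, Jth_half_shift, Jth_zero_shift, zero_add] at h
  have h0 := Complex.exp_ne_zero (π * Complex.I / 4)
  apply mul_left_cancel₀ h0
  linear_combination h

lemma wronskian_deriv {t : ℂ} (ht : t.re < 0) :
    th3 t * Jth 4 (1 / 2) t 0 - th2 t * Jth 4 0 t 0 = (1 / 4) * (Jth 2 0 t 0 * th2 t * th4 t ^ 4
      + th3 t * Jth 2 (1 / 2) t 0 * th4 t ^ 4
      + 4 * th3 t * th2 t * th4 t ^ 3 * Jth 2 0 t (π * Complex.I)) := by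
  have d3 : HasDerivAt th3 (Jth 2 0 t 0) t := Jth_hasDerivAt_t 0 0 ht 0
  have d4 : HasDerivAt th4 (Jth 2 0 t (π * Complex.I)) t := Jth_hasDerivAt_t 0 0 ht _
  have d2 : HasDerivAt th2 (Jth 2 (1 / 2) t 0) t := Jth_hasDerivAt_t 0 (1 / 2) ht 0
  have d3' : HasDerivAt (fun t => Jth 2 0 t 0) (Jth 4 0 t 0) t := Jth_hasDerivAt_t 2 0 ht 0
  have d2' : HasDerivAt (fun t => Jth 2 (1 / 2) t 0) (Jth 4 (1 / 2) t 0) t :=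
    Jth_hasDerivAt_t 2 (1 / 2) ht 0
  have hl := (d3.mul d2').sub (d2.mul d3')
  have hr := ((d3.mul d2).mul (d4.pow 4)).const_mul (1 / 4 : ℂ)
  have ho : IsOpen {t : ℂ | t.re < 0} := isOpen_lt (by fun_prop) (by fun_prop)
  have hc := hr.congr_of_eventuallyEq
    (f₁ := fun t => th3 t * Jth 2 (1 / 2) t 0 - th2 t * Jth 2 0 t 0) (by
      filter_upwards [ho.mem_nhds ht] with w hw using wronskian' hw)
  have := hl.unique hc
  simp only [Pi.mul_apply, Pi.pow_apply] at this
  push_cast at this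
  linear_combination this

/-- The elliptic variable. -/
noncomputable def GG (t u : ℂ) : ℂ := Jth 0 0 t (2 * u) * th2 t /
  (Jth 0 0 t (2 * u) * th2 t - Jth 0 (1 / 2) t (2 * u) * th3 t)

lemma GG_den_ne {t u : ℂ} (ht : t.re < 0) (hu : u ∈ dom t) :
    Jth 0 0 t (2 * u) * th2 t - Jth 0 (1 / 2) t (2 * u) * th3 t ≠ 0 := by
  have := Th_sq ht u
  rw [th2, th3, ← this]
  exact pow_ne_zero _ (Th_zero_ne ht hu)

lemma main_S3 {t : ℂ} (ht : t.re < 0) : ∃ c : ℂ, ∀ u ∈ dom t, -S3 t u =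
    c + (3 / 2) * th4 t ^ 8 * GG t u ^ 2
      - th4 t ^ 4 * ((5 / 2) * th4 t ^ 4 - 2 * th3 t ^ 4) * GG t u := by
  have n3 := th3_ne ht
  have n2 := th2_ne ht
  have n4 := th4_ne ht
  refine ⟨24 * (Jth 2 0 t 0 / th3 t) ^ 2 - 8 * (Jth 4 0 t 0 / th3 t), fun u hu => ?_⟩
  have hW := GG_den_ne ht hu
  have hs1 := S1_eq ht hu
  have hs3 := S3_eq ht hu
  rw [Th_sq ht] at hs1 hs3
  change _ * (_ * th2 t - _ * th3 t) = _ at hs1 hs3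
  have w1 := wronskian' ht
  have w2 := wronskian4 ht
  have w3 := wronskian_deriv ht
  unfold GG
  generalize Jth 0 0 t (2 * u) = a at *
  generalize Jth 0 (1 / 2) t (2 * u) = b at *
  obtain ⟨l3, h3⟩ : ∃ l, Jth 2 0 t 0 = th3 t * l := ⟨_, (mul_div_cancel₀ _ n3).symm⟩
  obtain ⟨l2, h2⟩ : ∃ l, Jth 2 (1 / 2) t 0 = th2 t * l := ⟨_, (mul_div_cancel₀ _ n2).symm⟩
  obtain ⟨l4, h4⟩ : ∃ l, Jth 2 0 t (π * Complex.I) = th4 t * l := ⟨_, (mul_div_cancel₀ _ n4).symm⟩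
  obtain ⟨m3, h5⟩ : ∃ l, Jth 4 0 t 0 = th3 t * l := ⟨_, (mul_div_cancel₀ _ n3).symm⟩
  obtain ⟨m2, h6⟩ : ∃ l, Jth 4 (1 / 2) t 0 = th2 t * l := ⟨_, (mul_div_cancel₀ _ n2).symm⟩
  rw [h2, h3] at w1 hs1
  rw [h2, h4] at w2
  rw [h2, h3, h4, h5, h6] at w3
  rw [h5, h6] at hs3
  rw [h3, h5, mul_div_cancel_left₀ _ n3, mul_div_cancel_left₀ _ n3]
  obtain ⟨G, hG⟩ : ∃ G, a * th2 t / (a * th2 t - b * th3 t) = G := ⟨_, rfl⟩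
  have hG' : a * th2 t = G * (a * th2 t - b * th3 t) := by rw [← hG]; field_simp
  rw [hG]
  have v1 : l2 - l3 = (1 / 4) * th4 t ^ 4 := by
    apply mul_left_cancel₀ (mul_ne_zero n3 n2); linear_combination w1
  have v2 : l2 - l4 = (1 / 4) * th3 t ^ 4 := by
    apply mul_left_cancel₀ (mul_ne_zero n4 n2); linear_combination w2
  have v3 : m2 - m3 = (1 / 4) * th4 t ^ 4 * (l3 + l2 + 4 * l4) := by
    apply mul_left_cancel₀ (mul_ne_zero n3 n2); linear_combination w3
  have s1 : S1 t u = 2 * (l3 + (l2 - l3) * G) := by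
    apply mul_right_cancel₀ hW
    linear_combination hs1 + 2 * (l2 - l3) * hG'
  have s3 : S3 t u + 6 * S1 t u ^ 2 = 8 * (m3 + (m2 - m3) * G) := by
    apply mul_right_cancel₀ hW
    linear_combination hs3 + 8 * (m2 - m3) * hG'
  rw [s1, v3, v1] at s3
  have e2 : l2 = l3 + (1 / 4) * th4 t ^ 4 := by linear_combination v1
  have e4 : l4 = l3 + (1 / 4) * th4 t ^ 4 - (1 / 4) * th3 t ^ 4 := by linear_combination v1 - v2
  rw [e2, e4] at s3
  linear_combination -s3


lemma Jhalf_piI (t : ℂ) : Jth 0 (1 / 2) t (π * Complex.I) = 0 := by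
  have h1 := Jth_half_add_two_pi 0 t (-(π * Complex.I))
  rw [show -(π * Complex.I) + 2 * π * Complex.I = π * Complex.I by ring, Jth_half_neg] at h1
  exact self_eq_neg.mp h1

lemma Jzero_two_piI (t : ℂ) : Jth 0 0 t (2 * π * Complex.I) = th3 t := by
  have := Jth_zero_add_two_pi 0 t 0
  rwa [zero_add] at this

lemma Jhalf_two_piI (t : ℂ) : Jth 0 (1 / 2) t (2 * π * Complex.I) = -th2 t := by
  have := Jth_half_add_two_pi 0 t 0
  rwa [zero_add] at this

lemma rel_A {t : ℂ} (ht : t.re < 0) : th3 t = th3 (4 * t) + th2 (4 * t) := by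
  have := Jth_split ht 0
  rwa [mul_zero] at this

lemma rel_B {t : ℂ} (ht : t.re < 0) : th4 t = th3 (4 * t) - th2 (4 * t) := by
  have := Jth_split ht (π * Complex.I)
  rw [← mul_assoc, Jzero_two_piI, Jhalf_two_piI, ← sub_eq_add_neg] at this
  exact this

lemma rel_A2 {t : ℂ} (ht : t.re < 0) : th3 t ^ 2 = th3 (2 * t) ^ 2 + th2 (2 * t) ^ 2 := by
  have := Jth_mul ht 0 0
  rw [add_zero, sub_zero] at this
  rw [sq, sq, sq]; exact this

lemma rel_B2 {t : ℂ} (ht : t.re < 0) : th4 t ^ 2 = th3 (2 * t) ^ 2 - th2 (2 * t) ^ 2 := by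
  have := Jth_mul ht (π * Complex.I) (π * Complex.I)
  rw [← two_mul, ← mul_assoc, sub_self, Jzero_two_piI, Jhalf_two_piI] at this
  change th4 t * th4 t = _ * th3 (2 * t) + _ * th2 (2 * t) at this
  linear_combination this

lemma rel_AB {t : ℂ} (ht : t.re < 0) : th3 t * th4 t = th4 (2 * t) ^ 2 := by
  have := Jth_mul ht 0 (π * Complex.I)
  rw [zero_add, zero_sub, Jth_zero_neg, Jhalf_piI, zero_mul, add_zero] at this
  rw [sq]; exact this

lemma rel_th2 {t : ℂ} (ht : t.re < 0) : th2 t ^ 2 = 2 * th3 (2 * t) * th2 (2 * t) := by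
  have := Jhalf_sq ht 0
  rw [mul_zero] at this
  change th2 t ^ 2 = th3 (2 * t) * th2 (2 * t) + th2 (2 * t) * th3 (2 * t) at this
  linear_combination this

/-- eighth root of unity -/
noncomputable def zt : ℂ := Complex.exp (π * Complex.I / 4)
/-- `√2` -/
noncomputable def rt : ℂ := zt - zt ^ 3

lemma zt_four : zt ^ 4 = -1 := by
  rw [zt, ← Complex.exp_nat_mul, ← Complex.exp_pi_mul_I]; congr 1; push_cast; ring
lemma zt_ne : zt ≠ 0 := Complex.exp_ne_zero _
lemma zt_inv : Complex.exp (-(π * Complex.I / 4)) = -zt ^ 3 := by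
  rw [Complex.exp_neg]
  change zt⁻¹ = _
  rw [inv_eq_iff_eq_inv, eq_comm, inv_eq_iff_eq_inv, eq_comm]
  apply inv_eq_of_mul_eq_one_right
  linear_combination -zt_four
lemma zt_sq : zt ^ 2 = Complex.I := by
  refine Eq.trans ?_ Complex.exp_pi_div_two_mul_I
  rw [zt, ← Complex.exp_nat_mul]; congr 1; push_cast; ring
lemma rt_sq : rt ^ 2 = 2 := by
  rw [rt]; linear_combination (-2 + zt ^ 2) * zt_four
lemma rt_ne : rt ≠ 0 := by
  intro h; have := rt_sq; rw [h] at this; norm_num at this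

/-- The auxiliary theta value. -/
noncomputable def hh (t : ℂ) : ℂ := Jth 0 (1 / 2) t (π * Complex.I / 2)

lemma hh_sq {t : ℂ} (ht : t.re < 0) : hh t ^ 2 = th4 (2 * t) * th2 (2 * t) := by
  have := Jhalf_sq ht (π * Complex.I / 2)
  rw [show 2 * (π * Complex.I / 2) = π * Complex.I by ring, Jhalf_piI, zero_mul, add_zero] at this
  exact this

lemma hh_eq {t : ℂ} (ht : t.re < 0) :
    hh t * Eu (4 * t) = rt * Complex.exp (t / 4) * Eu (2 * t) * Eu (8 * t) := by
  have hP := norm_exp_lt_one (re_two ht)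
  have hep := Ep_eq (re_four ht)
  rw [show 2 * (4 * t) = 8 * t by ring] at hep
  rw [hh, Jth_half_eq, jtp ht]
  have e1 : -Complex.exp (t + (π * Complex.I / 2 + t)) = -(Complex.I * Complex.exp (2 * t)) := by
    rw [show t + (π * Complex.I / 2 + t) = π / 2 * Complex.I + 2 * t by ring, Complex.exp_add,
      Complex.exp_pi_div_two_mul_I]
  have e2 : -Complex.exp (t - (π * Complex.I / 2 + t)) = Complex.I := by
    rw [show t - (π * Complex.I / 2 + t) = -(π / 2 * Complex.I) by ring, Complex.exp_neg,
      Complex.exp_pi_div_two_mul_I]; simp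
  have e3 : Complex.exp (t / 4 + π * Complex.I / 2 / 2) = zt * Complex.exp (t / 4) := by
    rw [zt, ← Complex.exp_add]; congr 1; ring
  have e4 := qp_mul_neg (Complex.I * Complex.exp (2 * t)) hP
  have e5 : (Complex.I * Complex.exp (2 * t)) ^ 2 = -Complex.exp (4 * t) := by
    rw [mul_pow, Complex.I_sq, ← exp_two, show 2 * (2 * t) = 4 * t by ring]; ring
  rw [e5, ← exp_two, show 2 * (2 * t) = 4 * t by ring] at e4
  rw [e1, e2, e3, qp_step Complex.I hP, ← hep, ← e4]
  change _ * _ * (Eu (2 * t) * _ * _) * _ = _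
  have : rt = zt * (1 - Complex.I) := by rw [← zt_sq, rt]; ring
  rw [this]
  ring

lemma hh_mul {t : ℂ} (ht : t.re < 0) : hh t * th2 t = rt * th2 (2 * t) * th4 (4 * t) := by
  have h1 := hh_eq ht
  have h2 := th2_eq ht
  have h3 := th2_eq (re_two ht)
  have h4 := th4_eq (re_four ht)
  rw [show 2 * (2 * t) = 4 * t by ring, show 4 * (2 * t) = 8 * t by ring] at h3
  rw [show 2 * (4 * t) = 8 * t by ring] at h4
  have n2 := Eu_ne (re_two ht)
  have n4 := Eu_ne (re_four ht)
  have n8 := Eu_ne (re_eight ht)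
  have he : Complex.exp (2 * t / 4) = Complex.exp (t / 4) ^ 2 := by
    rw [← Complex.exp_nat_mul]; congr 1; push_cast; ring
  rw [he] at h3
  apply mul_right_cancel₀ (mul_ne_zero (mul_ne_zero n4 n2) n8)
  calc _ = (hh t * Eu (4 * t)) * (th2 t * Eu (2 * t)) * Eu (8 * t) := by ring
    _ = rt * (th2 (2 * t) * Eu (4 * t)) * (th4 (4 * t) * Eu (8 * t)) * Eu (2 * t) := by
        rw [h1, h2, h3, h4]; ring
    _ = _ := by ring

lemma kap {u : ℂ} (hu : Complex.exp u ≠ 1) :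
    -(-2 * (1 / 4 - sg u ^ 2) ^ 2 + 4 * sg u ^ 2 * (1 / 4 - sg u ^ 2)) =
      Complex.exp u * (1 + 4 * Complex.exp u + Complex.exp u ^ 2) / (1 - Complex.exp u) ^ 4 := by
  have h0 : Complex.exp u - 1 ≠ 0 := sub_ne_zero.mpr hu
  have h1 : 1 - Complex.exp u ≠ 0 := sub_ne_zero.mpr hu.symm
  rw [sg, show 1 - Complex.exp u = -(Complex.exp u - 1) by ring]
  field_simp
  ring

lemma kap_zt {z : ℂ} (hz : z ^ 4 = -1) (h1 : z ≠ 1) :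
    z * (1 + 4 * z + z ^ 2) / (1 - z) ^ 4 = 8 + 11 / 2 * (z - z ^ 3) := by
  have h0 : 1 - z ≠ 0 := sub_ne_zero.mpr h1.symm
  rw [div_eq_iff (pow_ne_zero _ h0)]
  linear_combination (-((8) * z ^ 0 + (-55/2) * z ^ 1 + (22) * z ^ 2 + (-11/2) * z ^ 3)) * hz

lemma chi_zt (d : ℕ) : zt ^ d + (-zt ^ 3) ^ d - (zt ^ 3) ^ d - (-zt) ^ d
    = 2 * rt * ((ZMod.χ₈ (d : ZMod 8) : ℤ) : ℂ) := by
  have h4 := zt_four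
  have h8 : zt ^ 8 = 1 := by linear_combination (zt ^ 4 - 1) * h4
  have key : ∀ (k j : ℕ), (zt ^ (8 * k + j) + (-zt ^ 3) ^ (8 * k + j) - (zt ^ 3) ^ (8 * k + j)
      - (-zt) ^ (8 * k + j)) = zt ^ j + (-zt ^ 3) ^ j - (zt ^ 3) ^ j - (-zt) ^ j := by
    intro k j
    have a1 : (-zt ^ 3) ^ 8 = 1 := by
      calc (-zt ^ 3) ^ 8 = (zt ^ 8) ^ 3 := by ring
        _ = 1 := by rw [h8]; simp
    have a2 : (zt ^ 3) ^ 8 = 1 := by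
      calc (zt ^ 3) ^ 8 = (zt ^ 8) ^ 3 := by ring
        _ = 1 := by rw [h8]; simp
    have a3 : (-zt) ^ 8 = 1 := by
      calc (-zt) ^ 8 = zt ^ 8 := by ring
        _ = 1 := h8
    simp only [pow_add, pow_mul, h8, a1, a2, a3, one_pow, one_mul]
  have hd : (d : ZMod 8) = ((d % 8 : ℕ) : ZMod 8) := by simp
  rw [hd]
  conv_lhs => rw [← Nat.div_add_mod d 8]
  rw [key]
  have hlt : d % 8 < 8 := Nat.mod_lt _ (by norm_num)
  have h5 : zt ^ 5 = -zt := by linear_combination zt * h4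
  have h6 : zt ^ 6 = -zt ^ 2 := by linear_combination zt ^ 2 * h4
  have h7 : zt ^ 7 = -zt ^ 3 := by linear_combination zt ^ 3 * h4
  have h9 : zt ^ 9 = zt := by linear_combination zt * h8
  generalize d % 8 = j at *
  have c0 : ZMod.χ₈ ((0 : ℕ) : ZMod 8) = 0 := by decide
  have c1 : ZMod.χ₈ ((1 : ℕ) : ZMod 8) = 1 := by decide
  have c2 : ZMod.χ₈ ((2 : ℕ) : ZMod 8) = 0 := by decide
  have c3 : ZMod.χ₈ ((3 : ℕ) : ZMod 8) = -1 := by decide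
  have c4 : ZMod.χ₈ ((4 : ℕ) : ZMod 8) = 0 := by decide
  have c5 : ZMod.χ₈ ((5 : ℕ) : ZMod 8) = -1 := by decide
  have c6 : ZMod.χ₈ ((6 : ℕ) : ZMod 8) = 0 := by decide
  have c7 : ZMod.χ₈ ((7 : ℕ) : ZMod 8) = 1 := by decide
  have m15 : zt ^ 15 = -zt ^ 3 := by linear_combination zt ^ 7 * h8 + h7
  have m21 : zt ^ 21 = -zt := by linear_combination (zt ^ 13 + zt ^ 5) * h8 + h5
  interval_cases j
  · rw [c0]; simp
  · rw [c1, rt]; push_cast; ring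
  · rw [c2]; push_cast; ring
  · rw [c3, rt]; push_cast; ring_nf; rw [h9]; ring
  · rw [c4]; push_cast; ring
  · rw [c5, rt]; push_cast; ring_nf; rw [m15, h5]; ring
  · rw [c6]; push_cast; ring
  · rw [c7, rt]; push_cast; ring_nf; rw [m21, h7]; ring

/-- First Eisenstein series in terms of theta functions. -/
theorem T2_hasSum {t : ℂ} (ht : t.re < 0) :
    HasSum (fun p : ℕ × ℕ => ((ZMod.χ₈ ((p.2 + 1 : ℕ) : ZMod 8) : ℤ) : ℂ) * ((p.2 : ℂ) + 1) ^ 3 *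
      Complex.exp t ^ ((p.1 + 1) * (p.2 + 1)))
    (th3 t * th3 (2 * t) * th4 t ^ 2 * (6 * th4 t ^ 2 * th3 (2 * t) ^ 2 - (5 / 2) * th4 t ^ 4
      + 2 * th3 t ^ 4) - 11 / 2) := by
  obtain ⟨c, hc⟩ := main_S3 ht
  set x : ℂ := π * Complex.I / 4 with hx
  have ex : Complex.exp x = zt := rfl
  have ey : Complex.exp (3 * x) = zt ^ 3 := by rw [← ex, ← Complex.exp_nat_mul]; norm_num
  have ex' : Complex.exp (-x) = -zt ^ 3 := zt_inv
  have ey' : Complex.exp (-(3 * x)) = -zt := by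
    rw [show -(3 * x) = (3 : ℕ) * (-x) by push_cast; ring, Complex.exp_nat_mul, ex']
    linear_combination (-zt ^ 5 + zt) * zt_four
  have hz1 : zt ≠ 1 := by intro h; have := zt_four; rw [h] at this; norm_num at this
  have hz34 : (zt ^ 3) ^ 4 = -1 := by
    calc (zt ^ 3) ^ 4 = (zt ^ 4) ^ 3 := by ring
      _ = -1 := by rw [zt_four]; norm_num
  have hz3 : zt ^ 3 ≠ 1 := by intro h; rw [h] at hz34; norm_num at hz34
  have rx : x.re = 0 := by simp [hx]
  have dx : x ∈ dom t := ⟨by rw [rx]; simpa using ht, by rw [ex]; exact hz1⟩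
  have rx3 : (3 * x).re = 0 := by simp [hx]
  have dy : 3 * x ∈ dom t := ⟨by rw [rx3]; simpa using ht, by rw [ey]; exact hz3⟩
  have hcx := hc x dx
  have hcy := hc (3 * x) dy
  -- the values of GG
  have gx : Jth 0 0 t (2 * x) = th4 (4 * t) ∧ Jth 0 (1 / 2) t (2 * x) = hh t := by
    have e : 2 * x = π * Complex.I / 2 := by rw [hx]; ring
    rw [e]
    refine ⟨?_, rfl⟩
    rw [Jth_split ht, show 2 * (π * Complex.I / 2) = π * Complex.I by ring, Jhalf_piI, add_zero]
    rfl
  have gy : Jth 0 0 t (2 * (3 * x)) = th4 (4 * t) ∧ Jth 0 (1 / 2) t (2 * (3 * x)) = -hh t := by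
    have e : 2 * (3 * x) = -(2 * x) + 2 * π * Complex.I := by rw [hx]; ring
    rw [e, Jth_zero_add_two_pi, Jth_half_add_two_pi, Jth_zero_neg, Jth_half_neg, gx.1, gx.2]
    exact ⟨rfl, rfl⟩
  have wx := GG_den_ne ht dx
  have wy := GG_den_ne ht dy
  rw [gx.1, gx.2] at wx
  rw [gy.1, gy.2] at wy
  have nB := th4_ne ht
  have nD := th4_ne (re_two ht)
  have nE := th2_ne (re_two ht)
  have rC : 2 * th3 (2 * t) ^ 2 = th3 t ^ 2 + th4 t ^ 2 := by
    linear_combination -rel_A2 ht - rel_B2 ht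
  have rF := rel_AB (re_two ht)
  rw [show 2 * (2 * t) = 4 * t by ring] at rF
  have r2 := rel_th2 ht
  have rh := hh_sq ht
  have rm := hh_mul ht
  have hden : (th4 (4 * t) * th2 t - hh t * th3 t) * (th4 (4 * t) * th2 t - -hh t * th3 t)
      = th4 (2 * t) * th2 (2 * t) * th4 t ^ 2 := by
    linear_combination th4 (4 * t) ^ 2 * r2 - th3 t ^ 2 * rh - 2 * th3 (2 * t) * th2 (2 * t) * rF
      + th4 (2 * t) * th2 (2 * t) * rC
  have hsum : GG t x + GG t (3 * x) = 4 * th3 (2 * t) ^ 2 / th4 t ^ 2 := by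
    rw [GG, GG, gx.1, gx.2, gy.1, gy.2, div_add_div _ _ wx wy, hden,
      div_eq_div_iff (by positivity) (by positivity)]
    linear_combination (2 * th4 (4 * t) ^ 2 * th4 t ^ 2) * r2 -
      4 * th3 (2 * t) * th2 (2 * t) * th4 t ^ 2 * rF
  have hdiff : GG t x - GG t (3 * x) = 2 * rt * th3 t * th3 (2 * t) / th4 t ^ 2 := by
    rw [GG, GG, gx.1, gx.2, gy.1, gy.2, div_sub_div _ _ wx wy, hden,
      div_eq_div_iff (by positivity) (by positivity)]
    linear_combination (2 * th4 (4 * t) * th3 t * th4 t ^ 2) * rm -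
      2 * rt * th3 t * th2 (2 * t) * th4 t ^ 2 * rF
  have hmain : -S3 t x + S3 t (3 * x) = 2 * rt * (th3 t * th3 (2 * t) * th4 t ^ 2 *
      (6 * th4 t ^ 2 * th3 (2 * t) ^ 2 - (5 / 2) * th4 t ^ 4 + 2 * th3 t ^ 4)) := by
    have : -S3 t x + S3 t (3 * x) = (GG t x - GG t (3 * x)) * (th4 t ^ 4 *
      ((3 / 2) * th4 t ^ 4 * (GG t x + GG t (3 * x)) - ((5 / 2) * th4 t ^ 4 - 2 * th3 t ^ 4))) := by
      linear_combination hcx - hcy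
    rw [this, hsum, hdiff]
    field_simp
    ring
  have k1 := kap dx.2
  have k2 := kap dy.2
  rw [ex, kap_zt zt_four hz1] at k1
  rw [ey, kap_zt hz34 hz3] at k2
  have hlam : Lam 4 t x + Lam 4 t (-x) - Lam 4 t (3 * x) - Lam 4 t (-(3 * x)) = 2 * rt *
      (th3 t * th3 (2 * t) * th4 t ^ 2 * (6 * th4 t ^ 2 * th3 (2 * t) ^ 2 - (5 / 2) * th4 t ^ 4
      + 2 * th3 t ^ 4) - 11 / 2) := by
    have e9 : zt ^ 9 = zt := by linear_combination (zt ^ 5 - zt) * zt_four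
    rw [S3, S3] at hmain
    have : rt = zt - zt ^ 3 := rfl
    linear_combination hmain - k1 + k2 - (11 / 2) * e9 + 11 * this
  have s1 := (summable_lterm 4 (u := x) ht (by rw [rx]; linarith)).hasSum
  have s2 := (summable_lterm 4 (u := -x) ht (by rw [Complex.neg_re, rx]; linarith)).hasSum
  have s3 := (summable_lterm 4 (u := 3 * x) ht (by rw [rx3]; linarith)).hasSum
  have s4 := (summable_lterm 4 (u := -(3 * x)) ht (by rw [Complex.neg_re, rx3]; linarith)).hasSum
  have hs := (((s1.add s2).sub s3).sub s4).mul_left (2 * rt)⁻¹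
  have nr := rt_ne
  refine hasSum_cg hs ?_ ?_
  · rintro ⟨m, d⟩
    have hchi := chi_zt (d + 1)
    simp only [lterm]
    have hd : ((d : ℂ) + 1) ≠ 0 := by exact_mod_cast Nat.succ_ne_zero d
    have ee : ∀ w : ℂ, Complex.exp (((d : ℂ) + 1) * (((m : ℂ) + 1) * t + w)) =
        Complex.exp t ^ ((m + 1) * (d + 1)) * Complex.exp w ^ (d + 1) := by
      intro w
      rw [← Complex.exp_nat_mul, ← Complex.exp_nat_mul, ← Complex.exp_add]
      congr 1; push_cast; ring
    rw [ee, ee, ee, ee, ex, ex', ey, ey']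
    have e5 : ((d : ℂ) + 1) ^ 4 / ((d : ℂ) + 1) = ((d : ℂ) + 1) ^ 3 := by field_simp
    rw [e5, eq_inv_mul_iff_mul_eq₀ (mul_ne_zero two_ne_zero nr)]
    linear_combination (-(((d : ℂ) + 1) ^ 3 * Complex.exp t ^ ((m + 1) * (d + 1)))) * hchi
  · rw [eq_inv_mul_iff_mul_eq₀ (mul_ne_zero two_ne_zero nr)]
    exact hlam.symm


lemma Lam_fiber {t u : ℂ} (ht : t.re < 0) (hu : t.re + u.re < 0) :
    HasSum (fun d : ℕ => ((d : ℂ) + 1) ^ 3 * (Complex.exp (t + u) ^ (d + 1) /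
      (1 - Complex.exp t ^ (d + 1)))) (Lam 4 t u) := by
  have h1 := (Equiv.prodComm ℕ ℕ).hasSum_iff.mpr (summable_lterm 4 ht hu).hasSum
  refine h1.prod_fiberwise fun d => ?_
  have hq : ‖Complex.exp t ^ (d + 1)‖ < 1 := by
    rw [norm_pow]; exact pow_lt_one₀ (norm_nonneg _) (norm_exp_lt_one ht) (Nat.succ_ne_zero d)
  have h2 := (hasSum_geometric_of_norm_lt_one hq).mul_left
    (((d : ℂ) + 1) ^ 3 * Complex.exp (t + u) ^ (d + 1))
  refine hasSum_cg h2 ?_ ?_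
  · intro m
    simp only [Function.comp, Equiv.prodComm_apply, Prod.swap, lterm]
    have hd : ((d : ℂ) + 1) ≠ 0 := by exact_mod_cast Nat.succ_ne_zero d
    have e5 : ((d : ℂ) + 1) ^ 4 / ((d : ℂ) + 1) = ((d : ℂ) + 1) ^ 3 := by field_simp
    rw [e5, mul_assoc, ← pow_mul, ← Complex.exp_nat_mul, ← Complex.exp_nat_mul, ← Complex.exp_add]
    congr 2; push_cast; ring
  · rw [div_eq_mul_inv]; ring

lemma kap_hasSum {x : ℂ} (hx : ‖x‖ < 1) :
    HasSum (fun d : ℕ => ((d : ℂ) + 1) ^ 3 * x ^ (d + 1))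
      (x * (1 + 4 * x + x ^ 2) / (1 - x) ^ 4) := by
  have h0 : 1 - x ≠ 0 := by
    intro h; rw [← sub_eq_zero.mp h] at hx; simp at hx
  have h3 := hasSum_choose_mul_geometric_of_norm_lt_one 3 hx
  have h2 := hasSum_choose_mul_geometric_of_norm_lt_one 2 hx
  have h1 := hasSum_choose_mul_geometric_of_norm_lt_one 1 hx
  have := (((h3.mul_left 6).sub (h2.mul_left 6)).add h1).mul_left x
  refine hasSum_cg this ?_ ?_
  · intro d
    have c3 : (6 : ℂ) * ((d + 3).choose 3 : ℂ) = (d + 1) * (d + 2) * (d + 3) := by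
      have := Nat.cast_choose_eq_ascPochhammer_div ℂ (d + 3) 3
      rw [this]
      simp [ascPochhammer_succ_eval, ascPochhammer_eval_zero, Nat.factorial]
      ring
    have c2 : (2 : ℂ) * ((d + 2).choose 2 : ℂ) = (d + 1) * (d + 2) := by
      have := Nat.cast_choose_eq_ascPochhammer_div ℂ (d + 2) 2
      rw [this]
      simp [ascPochhammer_succ_eval, ascPochhammer_eval_zero, Nat.factorial]
      ring
    have c1 : ((d + 1).choose 1 : ℂ) = d + 1 := by simp
    rw [c1]
    linear_combination (-x * x ^ d) * c3 + (3 * x * x ^ d) * c2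
  · field_simp; ring

lemma chi_geom {y : ℂ} (hy : ‖y‖ < 1) :
    HasSum (fun m : ℕ => ((ZMod.χ₈ ((m + 1 : ℕ) : ZMod 8) : ℤ) : ℂ) * y ^ (m + 1))
      ((y - y ^ 3 - y ^ 5 + y ^ 7) / (1 - y ^ 8)) := by
  have hbd : ∀ a : ZMod 8, |ZMod.χ₈ a| ≤ 1 := by decide
  have hs : Summable (fun m : ℕ => ((ZMod.χ₈ (m : ZMod 8) : ℤ) : ℂ) * y ^ m) := by
    refine Summable.of_norm_bounded (summable_geometric_of_lt_one (norm_nonneg _) hy) fun m => ?_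
    rw [norm_mul, norm_pow]
    have : ‖((ZMod.χ₈ (m : ZMod 8) : ℤ) : ℂ)‖ ≤ 1 := by
      rw [Complex.norm_intCast]; exact_mod_cast hbd m
    exact mul_le_of_le_one_left (by positivity) this
  have h8 : (1 - y ^ 8) ≠ 0 := by
    intro h
    have h1 : ‖y ^ 8‖ = 1 := by rw [← sub_eq_zero.mp h]; simp
    have h2 : ‖y ^ 8‖ < 1 := by rw [norm_pow]; exact pow_lt_one₀ (norm_nonneg _) hy (by norm_num)
    linarith
  have h1 := hs.sum_add_tsum_nat_add 8
  have h2 : (∑' m : ℕ, ((ZMod.χ₈ ((m + 8 : ℕ) : ZMod 8) : ℤ) : ℂ) * y ^ (m + 8)) =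
      y ^ 8 * ∑' m : ℕ, ((ZMod.χ₈ (m : ZMod 8) : ℤ) : ℂ) * y ^ m := by
    rw [← tsum_mul_left]
    refine tsum_congr fun m => ?_
    have : ((m + 8 : ℕ) : ZMod 8) = (m : ZMod 8) := by
      push_cast; rw [show (8 : ZMod 8) = 0 by decide, add_zero]
    rw [this]; ring
  rw [h2] at h1
  have c0 : ZMod.χ₈ ((0 : ℕ) : ZMod 8) = 0 := by decide
  have c1 : ZMod.χ₈ ((1 : ℕ) : ZMod 8) = 1 := by decide
  have c2 : ZMod.χ₈ ((2 : ℕ) : ZMod 8) = 0 := by decide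
  have c3 : ZMod.χ₈ ((3 : ℕ) : ZMod 8) = -1 := by decide
  have c4 : ZMod.χ₈ ((4 : ℕ) : ZMod 8) = 0 := by decide
  have c5 : ZMod.χ₈ ((5 : ℕ) : ZMod 8) = -1 := by decide
  have c6 : ZMod.χ₈ ((6 : ℕ) : ZMod 8) = 0 := by decide
  have c7 : ZMod.χ₈ ((7 : ℕ) : ZMod 8) = 1 := by decide
  simp only [sum_range_succ, range_zero, sum_empty, c0, c1, c2, c3, c4, c5, c6, c7] at h1
  push_cast at h1
  have h3 := (hasSum_nat_add_iff' 1).mpr hs.hasSum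
  refine hasSum_cg h3 (fun _ => rfl) ?_
  rw [div_eq_iff h8]
  simp only [range_one, sum_singleton, c0]
  push_cast
  linear_combination h1

lemma psi_rel {t : ℂ} (ht : t.re < 0) :
    th4 (2 * t) * Jth 0 0 (2 * t) (t + π * Complex.I) = th4 t * Jth 0 0 (2 * t) t := by
  have a1 : -Complex.exp (2 * t + (t + π * Complex.I)) = Complex.exp t * Complex.exp (2 * t) := by
    rw [show 2 * t + (t + π * Complex.I) = t + 2 * t + π * Complex.I by ring, Complex.exp_add _ (π * Complex.I),
      Complex.exp_pi_mul_I, Complex.exp_add]; ring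
  have a2 : -Complex.exp (2 * t - (t + π * Complex.I)) = Complex.exp t := by
    rw [show 2 * t - (t + π * Complex.I) = t - π * Complex.I by ring, Complex.exp_sub,
      Complex.exp_pi_mul_I]; ring
  have a3 : -Complex.exp (2 * t + t) = -Complex.exp t * Complex.exp (2 * t) := by
    rw [Complex.exp_add]; ring
  have a4 : -Complex.exp (2 * t - t) = -Complex.exp t := by
    congr 2; ring
  have hP := norm_exp_lt_one (re_two ht)
  have e4 : Complex.exp (4 * t) = Complex.exp (2 * t) ^ 2 := by
    rw [← exp_two]; congr 1; ring
  have s1 := qp_split (Complex.exp t) hP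
  have s2 := qp_split (-Complex.exp t) hP
  rw [← e4] at s1 s2
  rw [jtp (re_two ht), jtp (re_two ht), a1, a2, a3, a4, show 2 * (2 * t) = 4 * t by ring]
  have h4 := th4_eq ht
  have h4' := th4_eq (re_two ht)
  rw [show 2 * (2 * t) = 4 * t by ring] at h4'
  have o1 := Od_eq ht
  have o2 := Op_eq ht
  have n1 := Eu_ne ht
  have n2 := Eu_ne (re_two ht)
  rw [s1] at o1
  rw [s2] at o2
  change _ * (Eu (4 * t) * _ * _) = _ * (Eu (4 * t) * _ * _)
  apply mul_right_cancel₀ (mul_ne_zero n2 n1)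
  calc _ = (th4 (2 * t) * Eu (4 * t)) * (qp (Complex.exp t) (Complex.exp (4 * t)) *
        qp (Complex.exp t * Complex.exp (2 * t)) (Complex.exp (4 * t)) * Eu (2 * t)) * Eu t := by ring
    _ = (th4 t * Eu (2 * t)) * (qp (-Complex.exp t) (Complex.exp (4 * t)) *
        qp (-Complex.exp t * Complex.exp (2 * t)) (Complex.exp (4 * t)) * Eu t * Eu (4 * t)) := by
        rw [h4, h4', o1, o2]; ring
    _ = _ := by ring

lemma T1_diff {t : ℂ} (ht : t.re < 0) :
    -S3 (8 * t) t + S3 (8 * t) (3 * t) = th3 t * th3 (2 * t) * (th3 t ^ 2 - th3 (2 * t) ^ 2) *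
      (th3 t ^ 4 + 4 * th3 t ^ 2 * th3 (2 * t) ^ 2 - th3 (2 * t) ^ 4) / 16 := by
  obtain ⟨c, hc⟩ := main_S3 (re_eight ht)
  have nexp : ∀ w : ℂ, w.re < 0 → Complex.exp w ≠ 1 := by
    intro w hw h
    have := norm_exp_lt_one hw
    rw [h] at this; simp at this
  have r8 : (8 * t).re = 8 * t.re := by simp
  have r3 : (3 * t).re = 3 * t.re := by simp
  have dx : t ∈ dom (8 * t) := ⟨by rw [r8, abs_of_neg ht]; linarith, nexp _ ht⟩
  have dy : 3 * t ∈ dom (8 * t) := by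
    have : (3 * t).re < 0 := by rw [r3]; linarith
    exact ⟨by rw [r8, abs_of_neg this, r3]; linarith, nexp _ this⟩
  have hcx := hc t dx
  have hcy := hc (3 * t) dy
  have wx := GG_den_ne (re_eight ht) dx
  have wy := GG_den_ne (re_eight ht) dy
  -- the theta values
  have y1 : Jth 0 (1 / 2) (8 * t) (2 * t) = Complex.exp t * Jth 0 0 (8 * t) (2 * (3 * t)) := by
    rw [← Jth_half_neg, Jth_half_eq]
    congr 2 <;> ring
  have y2 : Jth 0 0 (8 * t) (2 * t) = Complex.exp t * Jth 0 (1 / 2) (8 * t) (2 * (3 * t)) := by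
    rw [← Jth_zero_neg, Jth_zero_eq]
    congr 2 <;> ring
  have ne := Complex.exp_ne_zero t
  have nB := th4_ne ht
  have nc := th3_ne (re_four ht)
  have rA := rel_A ht
  have rB := rel_B ht
  have rC : 2 * th3 (2 * t) ^ 2 = th3 t ^ 2 + th4 t ^ 2 := by
    linear_combination -rel_A2 ht - rel_B2 ht
  have rD := rel_AB ht
  have rF := rel_AB (re_two ht)
  have r4 := rel_AB (re_four ht)
  have rC8 := rel_A (re_two ht)
  have rD8 := rel_B (re_two ht)
  rw [show 2 * (2 * t) = 4 * t by ring] at rF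
  rw [show 2 * (4 * t) = 8 * t by ring] at r4
  rw [show 4 * (2 * t) = 8 * t by ring] at rC8 rD8
  -- psi relations
  have p1 := Jth_mul (re_four ht) (2 * t) 0
  rw [add_zero, sub_zero, show 2 * (4 * t) = 8 * t by ring] at p1
  have p2 := Jth_mul (re_four ht) (2 * t + π * Complex.I) (π * Complex.I)
  rw [show 2 * t + π * Complex.I + π * Complex.I = 2 * t + 2 * π * Complex.I by ring,
    show 2 * t + π * Complex.I - π * Complex.I = 2 * t by ring, show 2 * (4 * t) = 8 * t by ring,
    Jth_zero_add_two_pi, Jth_half_add_two_pi] at p2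
  have p3 := psi_rel (re_two ht)
  rw [show 2 * (2 * t) = 4 * t by ring] at p3
  have p4 := Jth_mul (re_two ht) t t
  rw [sub_self, show 2 * (2 * t) = 4 * t by ring, ← two_mul] at p4
  have p5 := Jth_split (re_two ht) t
  rw [show 4 * (2 * t) = 8 * t by ring] at p5
  have p6 : Jth 0 (1 / 2) (4 * t) (2 * t) = Jth 0 0 (4 * t) (2 * t) := by
    rw [← Jth_half_neg, Jth_half_eq]
    rw [show 4 * t / 4 + -(2 * t) / 2 = 0 by ring, Complex.exp_zero, one_mul]
    congr 1; ring
  rw [p5, p6] at p4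
  change _ * th3 (4 * t) = _ at p1
  change _ * th4 (4 * t) = _ at p2
  change th4 (4 * t) * _ = _ at p3
  change _ = _ * th3 (4 * t) + _ * th2 (4 * t) at p4
  have gx : GG (8 * t) t = Jth 0 0 (8 * t) (2 * t) * th2 (8 * t) /
    (Jth 0 0 (8 * t) (2 * t) * th2 (8 * t) - Jth 0 (1 / 2) (8 * t) (2 * t) * th3 (8 * t)) := rfl
  have wy' : Jth 0 (1 / 2) (8 * t) (2 * t) * th2 (8 * t)
      - Jth 0 0 (8 * t) (2 * t) * th3 (8 * t) ≠ 0 := by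
    rw [y1, y2]
    intro h
    apply wy
    apply mul_left_cancel₀ ne
    linear_combination h
  have gy : GG (8 * t) (3 * t) = Jth 0 (1 / 2) (8 * t) (2 * t) * th2 (8 * t) /
    (Jth 0 (1 / 2) (8 * t) (2 * t) * th2 (8 * t) - Jth 0 0 (8 * t) (2 * t) * th3 (8 * t)) := by
    rw [GG, div_eq_div_iff wy wy', y1, y2]
    ring
  generalize Jth 0 0 (8 * t) (2 * t) = U at *
  generalize Jth 0 (1 / 2) (8 * t) (2 * t) = V at *
  generalize Jth 0 0 (4 * t) (2 * t) = k at *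
  generalize Jth 0 0 (4 * t) (2 * t + π * Complex.I) = k' at *
  have hK : th2 (8 * t) = (th3 (2 * t) - th4 (2 * t)) / 2 := by rw [rC8, rD8]; ring
  have hH : th3 (8 * t) = (th3 (2 * t) + th4 (2 * t)) / 2 := by rw [rC8, rD8]; ring
  have hcc : th3 (4 * t) = (th3 t + th4 t) / 2 := by rw [rA, rB]; ring
  have hth : th4 (8 * t) ^ 4 = th3 (4 * t) ^ 2 * (th3 (2 * t) * th4 (2 * t)) := by
    rw [show th4 (8 * t) ^ 4 = (th4 (8 * t) ^ 2) ^ 2 by ring, ← r4, mul_pow, ← rF]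
  have hs : U ^ 2 + V ^ 2 = (th3 t + th4 t) / 2 * k := by rw [← hcc]; linear_combination -p1
  have hd : U ^ 2 - V ^ 2 = th4 (2 * t) * k := by linear_combination -p2 + p3
  have huv : U * V = (th3 t - th4 t) * k / 4 := by
    rw [rA, rB]; linear_combination p4 / 2 + p1 / 2
  rw [hcc] at nc hth
  have nAB : th3 t + th4 t ≠ 0 := by intro h; apply nc; rw [h]; simp
  rw [hK, hH] at gx gy wx wy'
  rw [show th4 (8 * t) ^ 8 = (th4 (8 * t) ^ 4) ^ 2 by ring, hth, hH] at hcx hcy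
  generalize th3 (2 * t) = C at *
  generalize th4 (2 * t) = D at *
  generalize th3 t = A at *
  generalize th4 t = B at *
  generalize GG (8 * t) t = Gx at *
  generalize GG (8 * t) (3 * t) = Gy at *
  have hden : (U * ((C - D) / 2) - V * ((C + D) / 2)) * (V * ((C - D) / 2) - U * ((C + D) / 2))
      = k * (A ^ 2 - B ^ 2) * B / 8 := by
    linear_combination ((C - D) ^ 2 / 4 + (C + D) ^ 2 / 4) * huv - (C ^ 2 - D ^ 2) / 4 * hs
      - k / 4 * A * rD - k / 8 * B * rC
  have hdn := mul_ne_zero wx wy'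
  rw [hden] at hdn
  have hsum : Gx + Gy = 1 - 2 * (C * D) * ((A + B) * B)⁻¹ := by
    have e : 1 - 2 * (C * D) * ((A + B) * B)⁻¹ = ((A + B) * B - 2 * (C * D)) / ((A + B) * B) := by
      field_simp
    rw [e, gx, gy, div_add_div _ _ wx wy', hden, div_eq_div_iff hdn (mul_ne_zero nAB nB)]
    linear_combination (A + B) * B * (2 * ((C - D) ^ 2 / 4) * huv - (C ^ 2 - D ^ 2) / 4 * hs
      - k / 4 * A * rD - k / 8 * B * rC)
  have hdiff : Gx - Gy = -((A - B) * D) * ((A + B) * B)⁻¹ := by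
    rw [gx, gy, div_sub_div _ _ wx wy', hden, ← div_eq_mul_inv,
      div_eq_div_iff hdn (mul_ne_zero nAB nB)]
    linear_combination (A + B) * B * (-(C ^ 2 - D ^ 2) / 4 * hd - D * k / 4 * (rC / 2 + rD))
  have hi : ((A + B) * B) * ((A + B) * B)⁻¹ = 1 := mul_inv_cancel₀ (mul_ne_zero nAB nB)
  generalize ((A + B) * B)⁻¹ = i at *
  have hP2 : (C * D) ^ 2 = A * B * (A ^ 2 + B ^ 2) / 2 := by
    linear_combination D ^ 2 / 2 * rC - (A ^ 2 + B ^ 2) / 2 * rD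
  have hbr : (3 / 2) * (((A + B) / 2) ^ 2 * (C * D)) * (Gx + Gy) - ((5 / 2) *
      (((A + B) / 2) ^ 2 * (C * D)) - 2 * ((C + D) / 2) ^ 4)
      = (-11 * A ^ 4 - 6 * A ^ 2 * B ^ 2 + B ^ 4) / 32 := by
    have hH4 : ((C + D) / 2) ^ 4 = ((A + B) ^ 2 / 2 + 2 * (C * D)) ^ 2 / 16 := by
      have : (C + D) ^ 2 = (A + B) ^ 2 / 2 + 2 * (C * D) := by linear_combination rC / 2 - rD
      rw [← this]; ring
    rw [hsum, hH4]
    linear_combination (1 / 2 - (3 / 4) * (A + B) ^ 2 * i) * hP2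
      - (3 / 8) * (A + B) * A * (A ^ 2 + B ^ 2) * hi
  have hfin : -S3 (8 * t) t + S3 (8 * t) (3 * t) = (Gx - Gy) * (((A + B) / 2) ^ 2 * (C * D)) *
      ((-11 * A ^ 4 - 6 * A ^ 2 * B ^ 2 + B ^ 4) / 32) := by
    rw [← hbr]; linear_combination hcx - hcy
  have hc2 : A ^ 2 - C ^ 2 = (A ^ 2 - B ^ 2) / 2 := by linear_combination -rC / 2
  have hc4 : A ^ 4 + 4 * A ^ 2 * C ^ 2 - C ^ 4 = (11 * A ^ 4 + 6 * A ^ 2 * B ^ 2 - B ^ 4) / 4 := by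
    linear_combination (2 * A ^ 2 - C ^ 2 / 2 - (A ^ 2 + B ^ 2) / 4) * rC
  have hfac : (Gx - Gy) * (((A + B) / 2) ^ 2 * (C * D)) = -(A ^ 2 - B ^ 2) * A * C / 4 := by
    rw [hdiff]
    linear_combination (A - B) * i * (A + B) ^ 2 * C / 4 * rD - (A ^ 2 - B ^ 2) * A * C / 4 * hi
  rw [hfin, hfac, hc2, hc4]
  ring

/-- Second Eisenstein series in terms of theta functions. -/
theorem T1_hasSum {t : ℂ} (ht : t.re < 0) :
    HasSum (fun p : ℕ × ℕ => ((ZMod.χ₈ ((p.1 + 1 : ℕ) : ZMod 8) : ℤ) : ℂ) * ((p.2 : ℂ) + 1) ^ 3 *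
      Complex.exp t ^ ((p.1 + 1) * (p.2 + 1)))
    (th3 t * th3 (2 * t) * (th3 t ^ 2 - th3 (2 * t) ^ 2) *
      (th3 t ^ 4 + 4 * th3 t ^ 2 * th3 (2 * t) ^ 2 - th3 (2 * t) ^ 4) / 16) := by
  have hbd : ∀ a : ZMod 8, |ZMod.χ₈ a| ≤ 1 := by decide
  have hq := norm_exp_lt_one ht
  have hS : Summable (fun p : ℕ × ℕ => ((ZMod.χ₈ ((p.1 + 1 : ℕ) : ZMod 8) : ℤ) : ℂ) *
      ((p.2 : ℂ) + 1) ^ 3 * Complex.exp t ^ ((p.1 + 1) * (p.2 + 1))) := by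
    refine Summable.of_norm_bounded
      (summable_lterm 4 (u := 0) ht (by simpa using ht)).norm fun p => ?_
    have e : lterm 4 t 0 p = ((p.2 : ℂ) + 1) ^ 3 * Complex.exp t ^ ((p.1 + 1) * (p.2 + 1)) := by
      have hd : ((p.2 : ℂ) + 1) ≠ 0 := by exact_mod_cast Nat.succ_ne_zero p.2
      have e5 : ((p.2 : ℂ) + 1) ^ 4 / ((p.2 : ℂ) + 1) = ((p.2 : ℂ) + 1) ^ 3 := by field_simp
      rw [lterm, e5, ← Complex.exp_nat_mul]
      congr 2; push_cast; ring
    rw [e, mul_assoc, norm_mul]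
    have : ‖((ZMod.χ₈ ((p.1 + 1 : ℕ) : ZMod 8) : ℤ) : ℂ)‖ ≤ 1 := by
      rw [Complex.norm_intCast]; exact_mod_cast hbd _
    exact mul_le_of_le_one_left (norm_nonneg _) this
  have hy : ∀ d : ℕ, ‖Complex.exp t ^ (d + 1)‖ < 1 := fun d => by
    rw [norm_pow]; exact pow_lt_one₀ (norm_nonneg _) hq (Nat.succ_ne_zero d)
  have hL : HasSum (fun d : ℕ => ((d : ℂ) + 1) ^ 3 * ((Complex.exp t ^ (d + 1)
      - (Complex.exp t ^ (d + 1)) ^ 3 - (Complex.exp t ^ (d + 1)) ^ 5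
      + (Complex.exp t ^ (d + 1)) ^ 7) / (1 - (Complex.exp t ^ (d + 1)) ^ 8)))
      (∑' p : ℕ × ℕ, ((ZMod.χ₈ ((p.1 + 1 : ℕ) : ZMod 8) : ℤ) : ℂ) *
      ((p.2 : ℂ) + 1) ^ 3 * Complex.exp t ^ ((p.1 + 1) * (p.2 + 1))) := by
    have h1 := (Equiv.prodComm ℕ ℕ).hasSum_iff.mpr hS.hasSum
    refine h1.prod_fiberwise fun d => ?_
    refine hasSum_cg ((chi_geom (hy d)).mul_left (((d : ℂ) + 1) ^ 3)) ?_ rfl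
    intro m
    simp only [Function.comp, Equiv.prodComm_apply, Prod.swap]
    rw [← pow_mul, mul_comm (d + 1)]
    ring
  have r8 : (8 * t).re = 8 * t.re := by simp
  have r3 : (3 * t).re = 3 * t.re := by simp
  have r3n : (3 * t).re < 0 := by rw [r3]; linarith
  have l1 := Lam_fiber (re_eight ht) (u := t) (by rw [r8]; linarith)
  have l2 := Lam_fiber (re_eight ht) (u := -t) (by rw [r8, Complex.neg_re]; linarith)
  have l3 := Lam_fiber (re_eight ht) (u := 3 * t) (by rw [r8, r3]; linarith)
  have l4 := Lam_fiber (re_eight ht) (u := -(3 * t)) (by rw [r8, Complex.neg_re, r3]; linarith)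
  have k1 := kap_hasSum hq
  have k3 := kap_hasSum (norm_exp_lt_one r3n)
  have nexp : ∀ w : ℂ, w.re < 0 → Complex.exp w ≠ 1 := by
    intro w hw h
    have := norm_exp_lt_one hw
    rw [h] at this; simp at this
  have hR := ((((l1.add l2).add k1).sub l3).sub l4).sub k3
  have hR' := hasSum_cg hR (g := fun d : ℕ => ((d : ℂ) + 1) ^ 3 * ((Complex.exp t ^ (d + 1)
      - (Complex.exp t ^ (d + 1)) ^ 3 - (Complex.exp t ^ (d + 1)) ^ 5
      + (Complex.exp t ^ (d + 1)) ^ 7) / (1 - (Complex.exp t ^ (d + 1)) ^ 8))) ?_ rfl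
  · have hu := hL.unique hR'
    have hd := T1_diff ht
    rw [S3, S3] at hd
    have q1 := kap (nexp t ht)
    have q3 := kap (nexp _ r3n)
    rw [← hd]
    refine hasSum_cg hS.hasSum (fun _ => rfl) ?_
    rw [hu]
    linear_combination q1 - q3
  · intro d
    have e : ∀ (w : ℂ) (n : ℕ), w = n * t → Complex.exp w ^ (d + 1) = (Complex.exp t ^ (d + 1)) ^ n := by
      intro w n hw
      rw [hw, Complex.exp_nat_mul, ← pow_mul, ← pow_mul, mul_comm]
    rw [e (8 * t + t) 9 (by push_cast; ring), e (8 * t + -t) 7 (by push_cast; ring),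
      e (8 * t) 8 (by push_cast; ring), e (8 * t + 3 * t) 11 (by push_cast; ring),
      e (8 * t + -(3 * t)) 5 (by push_cast; ring), e (3 * t) 3 (by push_cast; ring)]
    have h8 : 1 - (Complex.exp t ^ (d + 1)) ^ 8 ≠ 0 := by
      intro h
      have h2 : ‖(Complex.exp t ^ (d + 1)) ^ 8‖ < 1 := by
        rw [norm_pow]; exact pow_lt_one₀ (norm_nonneg _) (hy d) (by norm_num)
      rw [← sub_eq_zero.mp h] at h2; simp at h2
    generalize Complex.exp t ^ (d + 1) = y at *
    field_simp
    ring


lemma eta_eq (z : ℂ) :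
    dedekindEta z = Complex.exp (2 * π * Complex.I * z / 24) * Eu (2 * π * Complex.I * z) := by
  rw [dedekindEta, Eu, qp]
  congr 1
  · congr 1; ring
  · refine tprod_congr fun m => ?_
    rw [← Complex.exp_nat_mul, ← Complex.exp_add]
    congr 2; ring

lemma thetas_eu {t : ℂ} (ht : t.re < 0) :
    th3 t = Eu (2 * t) ^ 5 / (Eu t ^ 2 * Eu (4 * t) ^ 2) ∧ th4 t = Eu t ^ 2 / Eu (2 * t) ∧
    th3 (2 * t) = Eu (4 * t) ^ 5 / (Eu (2 * t) ^ 2 * Eu (8 * t) ^ 2) ∧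
    th3 t ^ 2 - th4 t ^ 2 = 8 * Complex.exp t * Eu (8 * t) ^ 4 / Eu (4 * t) ^ 2 := by
  have n1 := Eu_ne ht
  have n2 := Eu_ne (re_two ht)
  have n4 := Eu_ne (re_four ht)
  have n8 := Eu_ne (re_eight ht)
  have e4 : 2 * (2 * t) = 4 * t := by ring
  have e8 : 4 * (2 * t) = 8 * t := by ring
  refine ⟨?_, ?_, ?_, ?_⟩
  · rw [eq_div_iff (by positivity)]; exact th3_eq ht
  · rw [eq_div_iff n2]; exact th4_eq ht
  · have := th3_eq (re_two ht)
    rw [e4, e8] at this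
    rw [eq_div_iff (by positivity)]; exact this
  · have := th2_eq (re_two ht)
    rw [e4, e8] at this
    rw [rel_A2 ht, rel_B2 ht, eq_div_iff (by positivity)]
    have he : Complex.exp (2 * t / 4) ^ 2 = Complex.exp t := by
      rw [← exp_two]; congr 1; ring
    rw [← he]
    linear_combination 2 * (th2 (2 * t) * Eu (4 * t) + 2 * Complex.exp (2 * t / 4) * Eu (8 * t) ^ 2) * this

lemma eta_pows (z : ℂ) : ∃ x : ℂ, x ≠ 0 ∧ x ^ 24 = Complex.exp (2 * π * Complex.I * z) ∧
    dedekindEta z = x * Eu (2 * π * Complex.I * z) ∧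
    dedekindEta (2 * z) = x ^ 2 * Eu (2 * (2 * π * Complex.I * z)) ∧
    dedekindEta (4 * z) = x ^ 4 * Eu (4 * (2 * π * Complex.I * z)) ∧
    dedekindEta (8 * z) = x ^ 8 * Eu (8 * (2 * π * Complex.I * z)) := by
  refine ⟨Complex.exp (2 * π * Complex.I * z / 24), Complex.exp_ne_zero _, ?_, eta_eq z, ?_, ?_, ?_⟩
  · rw [← Complex.exp_nat_mul]; congr 1; push_cast; ring
  all_goals
    rw [eta_eq, ← Complex.exp_nat_mul]
    congr 2
    · push_cast; ring
    · ring

lemma re_t {z : ℂ} (hz : 0 < z.im) : (2 * π * Complex.I * z).re < 0 := by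
  simp
  positivity

lemma eta1_eq {z : ℂ} (hz : 0 < z.im) {t : ℂ} (htz : t = 2 * π * Complex.I * z) :
    dedekindEta z ^ (-2 : ℤ) * dedekindEta (2 * z) ^ (11 : ℤ) * dedekindEta (4 * z) ^ (-3 : ℤ) * dedekindEta (8 * z) ^ (2 : ℤ)
      = th3 t ^ 3 * th4 t ^ 2 * (th3 t ^ 2 - th4 t ^ 2) * th3 (2 * t) / 8 := by
  have ht : t.re < 0 := by rw [htz]; exact re_t hz
  obtain ⟨x, hx, hx24, h1, h2, h4, h8⟩ := eta_pows z
  obtain ⟨eA, eB, eC, eD⟩ := thetas_eu ht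
  have n1 := Eu_ne ht
  have n2 := Eu_ne (re_two ht)
  have n4 := Eu_ne (re_four ht)
  have n8 := Eu_ne (re_eight ht)
  rw [eD, eA, eB, eC, h1, h2, h4, h8, ← htz]
  rw [← htz] at hx24
  rw [← hx24]
  have z1 : (-2 : ℤ) = -((2 : ℕ) : ℤ) := rfl
  have z2 : (-3 : ℤ) = -((3 : ℕ) : ℤ) := rfl
  have z3 : (11 : ℤ) = ((11 : ℕ) : ℤ) := rfl
  have z4 : (2 : ℤ) = ((2 : ℕ) : ℤ) := rfl
  rw [z1, z2, z3, z4, zpow_neg, zpow_neg, zpow_natCast, zpow_natCast, zpow_natCast, zpow_natCast]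
  generalize Eu (2 * t) = E2 at *
  generalize Eu (4 * t) = E4 at *
  generalize Eu (8 * t) = E8 at *
  generalize Eu t = E1 at *
  field_simp

lemma eta2_eq {z : ℂ} (hz : 0 < z.im) {t : ℂ} (htz : t = 2 * π * Complex.I * z) :
    dedekindEta z ^ (2 : ℤ) * dedekindEta (2 * z) ^ (-3 : ℤ) * dedekindEta (4 * z) ^ (11 : ℤ) * dedekindEta (8 * z) ^ (-2 : ℤ)
      = th3 t * th4 t ^ 2 * (th3 t ^ 2 - th4 t ^ 2) * th3 (2 * t) ^ 3 / 8 := by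
  have ht : t.re < 0 := by rw [htz]; exact re_t hz
  obtain ⟨x, hx, hx24, h1, h2, h4, h8⟩ := eta_pows z
  obtain ⟨eA, eB, eC, eD⟩ := thetas_eu ht
  have n1 := Eu_ne ht
  have n2 := Eu_ne (re_two ht)
  have n4 := Eu_ne (re_four ht)
  have n8 := Eu_ne (re_eight ht)
  rw [eD, eA, eB, eC, h1, h2, h4, h8, ← htz]
  rw [← htz] at hx24
  rw [← hx24]
  have z1 : (-2 : ℤ) = -((2 : ℕ) : ℤ) := rfl
  have z2 : (-3 : ℤ) = -((3 : ℕ) : ℤ) := rfl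
  have z3 : (11 : ℤ) = ((11 : ℕ) : ℤ) := rfl
  have z4 : (2 : ℤ) = ((2 : ℕ) : ℤ) := rfl
  rw [z1, z2, z3, z4, zpow_neg, zpow_neg, zpow_natCast, zpow_natCast, zpow_natCast, zpow_natCast]
  generalize Eu (2 * t) = E2 at *
  generalize Eu (4 * t) = E4 at *
  generalize Eu (8 * t) = E8 at *
  generalize Eu t = E1 at *
  field_simp

lemma th_diff_ne {t : ℂ} (ht : t.re < 0) : th3 t ^ 2 - th4 t ^ 2 ≠ 0 := by
  rw [(thetas_eu ht).2.2.2]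
  have n4 := Eu_ne (re_four ht)
  have n8 := Eu_ne (re_eight ht)
  simp [n4, n8]

/-- The theta-function identity behind the representation formula. -/
lemma main_identity {t : ℂ} (ht : t.re < 0) :
    11 * (th3 t ^ 2 * th3 (2 * t) ^ 3 * th3 (4 * t) ^ 3) =
      8 * (th3 t * th3 (2*t) * (th3 t^2 - th3 (2*t)^2) * (th3 t^4 + 4*th3 t^2*th3 (2*t)^2 - th3 (2*t)^4)/16)
      + 2 * ((th3 (2 * t) * th3 (2*(2 * t)) * th4 (2 * t)^2 * (6*th4 (2 * t)^2*th3 (2*(2 * t))^2 - (5/2)*th4 (2 * t)^4 + 2*th3 (2 * t)^4) - 11/2) + 11 / 2)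
      + 2 * (th3 t ^ 3 * th4 t ^ 2 * (th3 t ^ 2 - th4 t ^ 2) * th3 (2 * t) / 8)
      + 34 * (th3 t * th4 t ^ 2 * (th3 t ^ 2 - th4 t ^ 2) * th3 (2 * t) ^ 3 / 8)
      + 92 * (th3 (2 * t) ^ 3 * th4 (2 * t) ^ 2 * (th3 (2 * t) ^ 2 - th4 (2 * t) ^ 2) * th3 (2 * (2 * t)) / 8)
      + 16 * (th3 (2 * t) * th4 (2 * t) ^ 2 * (th3 (2 * t) ^ 2 - th4 (2 * t) ^ 2) * th3 (2 * (2 * t)) ^ 3 / 8) := by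
  have hc : th3 (2 * (2 * t)) = (th3 t + th4 t) / 2 := by
    rw [rel_A ht, rel_B ht]; ring_nf
  have hc' : th3 (4 * t) = (th3 t + th4 t) / 2 := by
    rw [rel_A ht, rel_B ht]; ring_nf
  have hC : th3 (2 * t) ^ 2 = (th3 t ^ 2 + th4 t ^ 2) / 2 := by
    rw [rel_A2 ht, rel_B2 ht]; ring
  have h4 : th4 (2 * t) ^ 4 = (th3 t * th4 t) ^ 2 := by rw [rel_AB ht]; ring
  have h34 : th3 (2 * t) ^ 4 = ((th3 t ^ 2 + th4 t ^ 2) / 2) ^ 2 := by rw [← hC]; ring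
  have h33 : th3 (2 * t) ^ 3 = th3 (2 * t) * ((th3 t ^ 2 + th4 t ^ 2) / 2) := by rw [← hC]; ring
  rw [hc, hc', h4, h34, h33, hC, ← rel_AB ht]
  ring


lemma hasSum_pi_prod : ∀ (k : ℕ) (f : Fin k → ℤ → ℂ) (_ : ∀ i, Summable fun n => ‖f i n‖),
    (Summable fun x : Fin k → ℤ => ‖∏ i, f i (x i)‖) ∧
    HasSum (fun x : Fin k → ℤ => ∏ i, f i (x i)) (∏ i, ∑' n, f i n)
  | 0, f, _ => by
    constructor
    · exact Summable.of_finite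
    · simpa using hasSum_unique (fun _ : Fin 0 → ℤ => (1 : ℂ))
  | k + 1, f, hf => by
    obtain ⟨i1, i2⟩ := hasSum_pi_prod k (fun i => f i.succ) (fun i => hf i.succ)
    have h0 := hf 0
    have hs := summable_mul_of_summable_norm h0 i1
    have hsn := Summable.mul_norm h0 i1
    have hp := (h0.of_norm.hasSum).mul i2 hs
    have e : ∀ p : ℤ × (Fin k → ℤ),
        ∏ i, f i ((Fin.consEquiv (fun _ : Fin (k + 1) => ℤ) p) i) = f 0 p.1 * ∏ i, f i.succ (p.2 i) := by
      intro p
      rw [Fin.prod_univ_succ]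
      simp [Fin.consEquiv]
    constructor
    · rw [← (Fin.consEquiv (fun _ : Fin (k + 1) => ℤ)).summable_iff]
      refine hsn.congr fun p => ?_
      simp only [Function.comp_apply]
      rw [e p]
    · rw [← (Fin.consEquiv (fun _ : Fin (k + 1) => ℤ)).hasSum_iff]
      refine hasSum_cg hp (fun p => ?_) ?_
      · simp only [Function.comp_apply]
        rw [e p]
      · rw [Fin.prod_univ_succ]

lemma hasSum_fiber {X : Type*} (F : X → ℕ) (w : X → ℂ) {q S : ℂ}
    (h : HasSum (fun x => w x * q ^ F x) S) :
    HasSum (fun n : ℕ => ∑' x : {x // F x = n}, w x * q ^ n) S := by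
  have h1 := (Equiv.sigmaFiberEquiv F).hasSum_iff.mpr h
  have h2 := h1.sigma (fun n => (h1.summable.sigma_factor n).hasSum)
  refine hasSum_cg h2 (fun n => ?_) rfl
  refine tsum_congr fun x => ?_
  obtain ⟨x, hx⟩ := x
  simp [Equiv.sigmaFiberEquiv, hx]

lemma th3_terms (t : ℂ) (a : ℕ) :
    th3 ((a : ℂ) * t) = ∑' n : ℤ, Complex.exp t ^ (a * n.natAbs ^ 2) := by
  rw [th3, Jth]
  refine tsum_congr fun n => ?_
  rw [← Complex.exp_nat_mul]
  have : ((n.natAbs : ℂ)) ^ 2 = (n : ℂ) ^ 2 := by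
    have := congrArg (Int.cast : ℤ → ℂ) (Int.natAbs_sq n)
    push_cast at this
    rw [← this]; simp
  push_cast
  rw [this]
  simp
  congr 1; ring

lemma th3_terms_summable {t : ℂ} (ht : t.re < 0) {a : ℕ} (ha : 0 < a) :
    Summable fun n : ℤ => ‖Complex.exp t ^ (a * n.natAbs ^ 2)‖ := by
  have ht' : ((a : ℂ) * t).re < 0 := by
    have : (0 : ℝ) < a := by exact_mod_cast ha
    simp; nlinarith
  refine (summable_Jth_norm 0 0 ht' 0).congr fun n => ?_
  rw [← Complex.exp_nat_mul]
  have : ((n.natAbs : ℂ)) ^ 2 = (n : ℂ) ^ 2 := by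
    have := congrArg (Int.cast : ℤ → ℂ) (Int.natAbs_sq n)
    push_cast at this
    rw [← this]; simp
  push_cast
  rw [this]
  simp
  congr 2; ring

lemma rep_hasSum {t : ℂ} (ht : t.re < 0) :
    HasSum (fun n : ℕ => (repCount ![1, 1, 2, 2, 2, 4, 4, 4] n : ℂ) * Complex.exp t ^ n)
      (th3 t ^ 2 * th3 (2 * t) ^ 3 * th3 (4 * t) ^ 3) := by
  set a : Fin 8 → ℕ := ![1, 1, 2, 2, 2, 4, 4, 4] with ha
  have hpos : ∀ i, 0 < a i := by rw [ha]; decide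
  have h := (hasSum_pi_prod 8 (fun i n => Complex.exp t ^ (a i * n.natAbs ^ 2))
    (fun i => th3_terms_summable ht (hpos i))).2
  have h' := hasSum_cg h (g := fun x : Fin 8 → ℤ => (1 : ℂ) * Complex.exp t ^ (∑ i, a i * (x i).natAbs ^ 2))
    (b := th3 t ^ 2 * th3 (2 * t) ^ 3 * th3 (4 * t) ^ 3) ?_ ?_
  · refine hasSum_cg (hasSum_fiber _ _ h') (fun n => ?_) rfl
    rw [tsum_const, nsmul_eq_mul, one_mul]
    congr 2
    rw [repCount]
    refine Nat.card_congr (Equiv.subtypeEquivRight fun x => ?_)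
    have : ∑ i, (a i : ℤ) * x i ^ 2 = ((∑ i, a i * (x i).natAbs ^ 2 : ℕ) : ℤ) := by
      push_cast
      refine Finset.sum_congr rfl fun i _ => ?_
      rw [sq_abs]
    rw [this]
    exact_mod_cast Iff.rfl
  · intro x
    rw [one_mul, Finset.prod_pow_eq_pow_sum]
  · have : ∀ i, ∑' n : ℤ, Complex.exp t ^ (a i * n.natAbs ^ 2) = th3 ((a i : ℂ) * t) :=
      fun i => (th3_terms t (a i)).symm
    simp only [this]
    rw [ha]
    simp [Fin.prod_univ_succ]
    ring

lemma hasSum_divisors (w : ℕ → ℕ → ℂ) {q S : ℂ}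
    (h : HasSum (fun p : ℕ × ℕ => w (p.1 + 1) (p.2 + 1) * q ^ ((p.1 + 1) * (p.2 + 1))) S) :
    HasSum (fun n : ℕ => (∑ d ∈ n.divisors, w (n / d) d) * q ^ n) S := by
  refine hasSum_cg (hasSum_fiber (fun p : ℕ × ℕ => (p.1 + 1) * (p.2 + 1))
    (fun p => w (p.1 + 1) (p.2 + 1)) h) (fun n => ?_) rfl
  have hset : {p : ℕ × ℕ | (p.1 + 1) * (p.2 + 1) = n} =
      ((n.divisors.image fun d => ((n / d - 1, d - 1) : ℕ × ℕ) : Finset (ℕ × ℕ)) : Set (ℕ × ℕ)) := by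
    ext ⟨x, y⟩
    simp only [Set.mem_ofPred_eq, Finset.coe_image, Set.mem_image, Finset.mem_coe, Nat.mem_divisors,
      Prod.mk.injEq]
    constructor
    · intro hxy
      refine ⟨y + 1, ⟨⟨x + 1, by rw [← hxy]; ring⟩, ?_⟩, ?_, rfl⟩
      · rw [← hxy]; positivity
      · rw [← hxy, Nat.mul_div_cancel _ (Nat.succ_pos y)]; rfl
    · rintro ⟨d, ⟨⟨e, he⟩, hn⟩, h1, h2⟩
      have hd : 0 < d := Nat.pos_of_ne_zero fun h => hn (by rw [he, h, zero_mul])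
      have he0 : 0 < e := Nat.pos_of_ne_zero fun h => hn (by rw [he, h, mul_zero])
      rw [he, Nat.mul_div_cancel_left _ hd] at h1
      rw [← h1, ← h2, Nat.sub_add_cancel hd, Nat.sub_add_cancel he0, he, mul_comm]
  have e1 : ∑' x : {x : ℕ × ℕ // (x.1 + 1) * (x.2 + 1) = n},
      w (x.1.1 + 1) (x.1.2 + 1) * q ^ n =
      ∑' x : ({p : ℕ × ℕ | (p.1 + 1) * (p.2 + 1) = n} : Set (ℕ × ℕ)),
        (fun p : ℕ × ℕ => w (p.1 + 1) (p.2 + 1) * q ^ n) x := rfl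
  rw [e1, hset]
  refine Eq.trans ?_ (Finset.tsum_subtype (n.divisors.image fun d => ((n / d - 1, d - 1) : ℕ × ℕ))
    (fun p : ℕ × ℕ => w (p.1 + 1) (p.2 + 1) * q ^ n)).symm
  rw [Finset.sum_image, Finset.sum_mul]
  · refine Finset.sum_congr rfl fun d hd => ?_
    have hd0 := Nat.pos_of_mem_divisors hd
    have hd1 := Nat.div_pos (Nat.divisor_le hd) hd0
    simp only
    rw [Nat.sub_add_cancel hd0, Nat.sub_add_cancel hd1]
  · intro d hd d' hd' hh
    have hd0 := Nat.pos_of_mem_divisors hd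
    have hd0' := Nat.pos_of_mem_divisors hd'
    simp only [Prod.mk.injEq] at hh
    omega

lemma sig1_hasSum {t : ℂ} (ht : t.re < 0) :
    HasSum (fun n : ℕ => (sigmaChi8One n : ℂ) * Complex.exp t ^ n)
    (th3 t * th3 (2*t) * (th3 t^2 - th3 (2*t)^2) * (th3 t^4 + 4*th3 t^2*th3 (2*t)^2 - th3 (2*t)^4)/16) := by
  have h := hasSum_divisors (fun e d => ((ZMod.χ₈ (e : ZMod 8) : ℤ) : ℂ) * (d : ℂ) ^ 3)
    (hasSum_cg (T1_hasSum ht) (fun p => by push_cast; rfl) rfl)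
  refine hasSum_cg h (fun n => ?_) rfl
  rw [sigmaChi8One]; push_cast; rfl

lemma sig2_hasSum {t : ℂ} (ht : t.re < 0) :
    HasSum (fun n : ℕ => (sigmaOneChi8 n : ℂ) * Complex.exp t ^ n)
    (th3 t * th3 (2*t) * th4 t^2 * (6*th4 t^2*th3 (2*t)^2 - (5/2)*th4 t^4 + 2*th3 t^4) - 11/2) := by
  have h := hasSum_divisors (fun e d => ((ZMod.χ₈ (d : ZMod 8) : ℤ) : ℂ) * (d : ℂ) ^ 3)
    (hasSum_cg (T2_hasSum ht) (fun p => by push_cast; rfl) rfl)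
  refine hasSum_cg h (fun n => ?_) rfl
  rw [sigmaOneChi8]; push_cast; rfl

lemma half_hasSum (f : ℕ → ℤ) {q S : ℂ} (h : HasSum (fun n : ℕ => (f n : ℂ) * (q ^ 2) ^ n) S) :
    HasSum (fun n : ℕ => (half f n : ℂ) * q ^ n) S := by
  have hi : Function.Injective (fun n : ℕ => 2 * n) := fun a b h => by simpa using h
  rw [← hi.hasSum_iff]
  · refine hasSum_cg h (fun n => ?_) rfl
    simp [half, pow_mul]
  · intro n hn
    have : ¬ 2 ∣ n := fun ⟨k, hk⟩ => hn ⟨k, hk.symm⟩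
    simp [half, this]

/-- Cut off the value at `0`. -/
def cut (a : ℕ → ℤ) (n : ℕ) : ℤ := if n = 0 then 0 else a n

lemma cut_hasSum (a : ℕ → ℤ) {q S : ℂ} (hS : S ≠ 0)
    (h : S = ∑' m : ℕ, (a (m + 1) : ℂ) * q ^ (m + 1)) :
    HasSum (fun n : ℕ => (cut a n : ℂ) * q ^ n) S := by
  have hs : Summable fun m : ℕ => (a (m + 1) : ℂ) * q ^ (m + 1) := by
    by_contra hc
    exact hS (by rw [h, tsum_eq_zero_of_not_summable hc])
  have hh := hs.hasSum
  rw [← h] at hh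
  have := (hasSum_nat_add_iff (f := fun n : ℕ => (cut a n : ℂ) * q ^ n) 1 (g := S)).mp
    (hasSum_cg hh (fun m => by simp [cut]) rfl)
  simpa [cut] using this

lemma coeff_unique (c : ℕ → ℂ)
    (h : ∀ t : ℂ, t.re < 0 → HasSum (fun n : ℕ => c n * Complex.exp t ^ n) 0) : ∀ n, c n = 0 := by
  have h' : ∀ q : ℂ, q ≠ 0 → ‖q‖ < 1 → HasSum (fun n : ℕ => c n * q ^ n) 0 := by
    intro q hq hq1
    have := h (Complex.log q) (by
      rw [Complex.log_re]; exact Real.log_neg (norm_pos_iff.mpr hq) hq1)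
    rwa [Complex.exp_log hq] at this
  classical
  set g : ℂ → ℂ := fun y => if y = 0 then c 0 else 0 with hg
  set p := FormalMultilinearSeries.ofScalars ℂ c with hp
  have hball : HasFPowerSeriesOnBall g p 0 ((1 / 2 : NNReal) : ENNReal) := by
    refine ⟨?_, by simp, ?_⟩
    · refine FormalMultilinearSeries.le_radius_of_summable_norm _ ?_
      have := (h' (1 / 2) (by norm_num) (by norm_num)).summable.norm
      refine this.congr fun n => ?_
      simp [hp, FormalMultilinearSeries.ofScalars_norm]
    · intro y hy
      simp only [hp, FormalMultilinearSeries.ofScalars_apply_eq, zero_add, smul_eq_mul]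
      by_cases hy0 : y = 0
      · subst hy0
        have := hasSum_single (f := fun n : ℕ => c n * (0 : ℂ) ^ n) 0 (fun n hn => by simp [hn])
        simpa [hg] using this
      · have hy1 : ‖y‖ < 1 := by
          have : ‖y‖ < 1 / 2 := by
            rw [Metric.mem_eball, edist_zero_right] at hy
            have h2 : ‖y‖₊ < (1 / 2 : NNReal) := by exact_mod_cast hy
            have := NNReal.coe_lt_coe.mpr h2
            simpa using this
          linarith
        simpa [hg, hy0] using h' y hy0 hy1
  have hc0 : c 0 = 0 := by
    have hcont : ContinuousAt g 0 := hball.hasFPowerSeriesAt.continuousAt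
    have h1 : Filter.Tendsto g (nhdsWithin 0 {0}ᶜ) (nhds (g 0)) :=
      hcont.tendsto.mono_left nhdsWithin_le_nhds
    have h2 : Filter.Tendsto g (nhdsWithin 0 {0}ᶜ) (nhds 0) := by
      refine tendsto_const_nhds.congr' ?_
      filter_upwards [self_mem_nhdsWithin] with y hy
      have : y ≠ 0 := hy
      simp [hg, this]
    have := tendsto_nhds_unique h1 h2
    simpa [hg] using this
  have hg0 : g = fun _ => 0 := by
    funext y; simp [hg, hc0]
  have hp0 : p = 0 := by
    have hA := hball.hasFPowerSeriesAt
    rw [hg0] at hA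
    exact hA.eq_zero
  intro n
  have : p.coeff n = 0 := by rw [hp0]; rfl
  rwa [hp, FormalMultilinearSeries.coeff_ofScalars] at this

theorem representation_formula_4
    (a1 a2 : ℕ → ℤ)
    (ha1 : ∀ z : ℂ, 0 < z.im →
      dedekindEta z ^ (-2 : ℤ) * dedekindEta (2 * z) ^ (11 : ℤ) * dedekindEta (4 * z) ^ (-3 : ℤ) * dedekindEta (8 * z) ^ (2 : ℤ)
        = ∑' m : ℕ, (a1 (m + 1) : ℂ) * Complex.exp (2 * Real.pi * Complex.I * z) ^ (m + 1))
    (ha2 : ∀ z : ℂ, 0 < z.im →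
      dedekindEta z ^ (2 : ℤ) * dedekindEta (2 * z) ^ (-3 : ℤ) * dedekindEta (4 * z) ^ (11 : ℤ) * dedekindEta (8 * z) ^ (-2 : ℤ)
        = ∑' m : ℕ, (a2 (m + 1) : ℂ) * Complex.exp (2 * Real.pi * Complex.I * z) ^ (m + 1))
    (n : ℕ) (hn : 0 < n) :
    (repCount ![1, 1, 2, 2, 2, 4, 4, 4] n : ℚ) =
    (((8 : ℚ) / 11) * (sigmaChi8One n : ℚ) + ((2 : ℚ) / 11) * half sigmaOneChi8 n
      + ((2 : ℚ) / 11) * (a1 n : ℚ) + ((34 : ℚ) / 11) * (a2 n : ℚ)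
      + ((92 : ℚ) / 11) * half a1 n + ((16 : ℚ) / 11) * half a2 n) := by
  have hz : ∀ t : ℂ, t.re < 0 → ∃ z : ℂ, 0 < z.im ∧ t = 2 * π * Complex.I * z := by
    intro t ht
    have h2 : t = 2 * π * Complex.I * (-Complex.I * t / (2 * π)) := by
      have : (π : ℂ) ≠ 0 := by exact_mod_cast Real.pi_ne_zero
      field_simp
      rw [Complex.I_sq]; ring
    refine ⟨-Complex.I * t / (2 * π), ?_, h2⟩
    have h3 : -Complex.I * t / (2 * π) = -Complex.I * t / ((2 * π : ℝ) : ℂ) := by push_cast; rfl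
    rw [h3, Complex.div_ofReal_im]
    refine div_pos ?_ (by positivity)
    simp; linarith
  have hA1 : ∀ t : ℂ, t.re < 0 → HasSum (fun n : ℕ => (cut a1 n : ℂ) * Complex.exp t ^ n)
      (th3 t ^ 3 * th4 t ^ 2 * (th3 t ^ 2 - th4 t ^ 2) * th3 (2 * t) / 8) := by
    intro t ht
    obtain ⟨z, hz1, hz2⟩ := hz t ht
    have h := ha1 z hz1
    rw [eta1_eq hz1 hz2, ← hz2] at h
    refine cut_hasSum a1 ?_ h
    simp [th3_ne ht, th4_ne ht, th3_ne (re_two ht), th_diff_ne ht]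
  have hA2 : ∀ t : ℂ, t.re < 0 → HasSum (fun n : ℕ => (cut a2 n : ℂ) * Complex.exp t ^ n)
      (th3 t * th4 t ^ 2 * (th3 t ^ 2 - th4 t ^ 2) * th3 (2 * t) ^ 3 / 8) := by
    intro t ht
    obtain ⟨z, hz1, hz2⟩ := hz t ht
    have h := ha2 z hz1
    rw [eta2_eq hz1 hz2, ← hz2] at h
    refine cut_hasSum a2 ?_ h
    simp [th3_ne ht, th4_ne ht, th3_ne (re_two ht), th_diff_ne ht]
  have key := coeff_unique (fun n => 11 * (repCount ![1, 1, 2, 2, 2, 4, 4, 4] n : ℂ)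
      - (8 * (sigmaChi8One n : ℂ) + 2 * (half sigmaOneChi8 n : ℂ) + (if n = 0 then 11 else 0)
      + 2 * (cut a1 n : ℂ) + 34 * (cut a2 n : ℂ) + 92 * (half (cut a1) n : ℂ)
      + 16 * (half (cut a2) n : ℂ))) ?_ n
  · have hn0 : n ≠ 0 := hn.ne'
    have hh : ∀ a : ℕ → ℤ, half (cut a) n = half a n := by
      intro a
      unfold half cut
      split_ifs with h1 h2 <;> first | rfl | (exfalso; omega)
    have hc : ∀ a : ℕ → ℤ, cut a n = a n := fun a => by simp [cut, hn0]
    simp only [hh, hc, hn0, if_false] at key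
    have key' : (11 * (repCount ![1, 1, 2, 2, 2, 4, 4, 4] n : ℚ)
      - (8 * (sigmaChi8One n : ℚ) + 2 * (half sigmaOneChi8 n : ℚ) + 0
      + 2 * (a1 n : ℚ) + 34 * (a2 n : ℚ) + 92 * (half a1 n : ℚ)
      + 16 * (half a2 n : ℚ))) = 0 := by exact_mod_cast key
    linear_combination key' / 11
  · intro t ht
    have r2 := re_two ht
    have b2 := sig2_hasSum r2
    have c1 := hA1 _ r2
    have c2 := hA2 _ r2
    rw [exp_two] at b2 c1 c2
    have hone : HasSum (fun n : ℕ => (if n = 0 then (11 : ℂ) else 0) * Complex.exp t ^ n) 11 := by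
      have := hasSum_single (f := fun n : ℕ => (if n = 0 then (11 : ℂ) else 0) * Complex.exp t ^ n) 0
        (fun n hn => by simp [hn])
      simpa using this
    have tot := ((rep_hasSum ht).mul_left 11).sub ((((((((sig1_hasSum ht).mul_left 8).add
      ((half_hasSum _ b2).mul_left 2)).add hone).add ((hA1 t ht).mul_left 2)).add
      ((hA2 t ht).mul_left 34)).add ((half_hasSum _ c1).mul_left 92)).add
      ((half_hasSum _ c2).mul_left 16))
    refine hasSum_cg tot (fun n => by ring) ?_
    rw [main_identity ht]
    ring
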